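/- arXiv:1305.5746 — 2 statements merged into one kernel-verified Lean document; each statement's English description precedes it below -/
import Mathlib

section
/- Let ρ < −1 and let g ∈ C([0,∞) : M₊([0,∞) : (1+ω)^ρ)) be a weak solution with interacting condensate of the isotropic weak turbulence equation with σ = 0 and initial datum g_in with total mass m := ∫ g_in(dω) > 0. Let A := supp(g_in), A* its extended set and suppose R* := inf(A*) = 0. Then exactly one of the following two alternatives holds. (i) There exists t* ∈ [0,∞) such that g(t,{0}) > 0 for a.e. t ≥ t*; moreover, for a.e. pair t₁ ≤ t₂ one has g(t₁,{0}) ≤ g(t₂,{0}). (ii) g(t,{0}) = 0 for all t ≥ 0, and there exists an unbounded set A ⊂ [0,∞) of Lebesgue density one, i.e. lim_{T→∞} |A ∩ [0,T]|/T = 1, together with functions Ω, η : A → (0,∞) satisfying η(t) → 0 and Ω(t) → 0 as t → ∞ along A, such that for every t ∈ A, ∫_{(Ω(t)(1−η(t)), Ω(t)(1+η(t)))} g(t,dω) ≥ m (1 − η(t)); moreover, for every ε > 0 there exists T₀ such that for all s, t ∈ A with T₀ ≤ t ≤ s, one has Ω(s) ≤ (1+ε) Ω(t). -/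
open MeasureTheory Real Set Filter Pointwise

noncomputable section

/-- The minimum of the four square roots appearing in the collision kernel. -/
def Phi4 (σ a b c d : ℝ) : ℝ :=
  min (min (Real.sqrt (max (a - σ) 0)) (Real.sqrt (max (b - σ) 0)))
      (min (Real.sqrt (max (c - σ) 0)) (Real.sqrt (max (d - σ) 0)))

/-- The collision kernel `Φ_σ(ω₁,ω₂,ω₃)` with `ω₄ = ω₁+ω₂-ω₃`. -/
def PhiKer (σ ω₁ ω₂ ω₃ : ℝ) : ℝ :=
  if 0 ≤ ω₁ + ω₂ - ω₃ then Phi4 σ ω₁ ω₂ ω₃ (ω₁ + ω₂ - ω₃) else 0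

/-- Membership in `M₊([0,∞) : (1+ω)^ρ)`: a nonnegative measure supported on `[0,∞)`
with `sup_{R>0} (1+R)^{-ρ} R⁻¹ μ([R/2,R]) < ∞`. -/
def MemMplus (ρ : ℝ) (μ : Measure ℝ) : Prop :=
  μ (Set.Iio 0) = 0 ∧
  ∃ C : ℝ, ∀ R : ℝ, 0 < R →
    μ (Set.Icc (R / 2) R) ≤ ENNReal.ofReal (C * (1 + R) ^ ρ * R)

/-- Weak-* continuity in time on `[0,∞)`. -/
def WeakCont (g : ℝ → Measure ℝ) : Prop :=
  ∀ φ : ℝ → ℝ, Continuous φ → HasCompactSupport φ →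
    ContinuousOn (fun t => ∫ ω, φ ω ∂(g t)) (Set.Ici 0)

/-- The cubic collision term tested against `ψ`. -/
def collisionInt (σ : ℝ) (μ : Measure ℝ) (ψ : ℝ → ℝ) : ℝ :=
  ∫ ω₁, (∫ ω₂, (∫ ω₃,
    (PhiKer σ ω₁ ω₂ ω₃ / Real.sqrt (ω₁ * ω₂ * ω₃)) *
      (ψ (ω₁ + ω₂ - ω₃) + ψ ω₃ - ψ ω₁ - ψ ω₂) ∂μ) ∂μ) ∂μ

/-- Test functions: `C²` with compact support. -/
def IsTestFun (φ : ℝ → ℝ → ℝ) : Prop :=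
  ContDiff ℝ 2 (Function.uncurry φ) ∧ HasCompactSupport (Function.uncurry φ)

/-- Weak solution with interacting condensate of the isotropic weak turbulence
equation, with kernel `Φ_σ`, on the time interval `[0,∞)`. -/
def IsWeakSolution (ρ σ : ℝ) (g0 : Measure ℝ) (g : ℝ → Measure ℝ) : Prop :=
  (∀ t : ℝ, 0 ≤ t → MemMplus ρ (g t)) ∧ WeakCont g ∧ g 0 = g0 ∧
  ∀ φ : ℝ → ℝ → ℝ, IsTestFun φ → ∀ tstar : ℝ, 0 ≤ tstar →
    ((∫ ω, φ tstar ω ∂(g tstar)) - ∫ ω, φ 0 ω ∂g0)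
      = (∫ t in Set.Ioc (0:ℝ) tstar, (∫ ω, deriv (fun s => φ s ω) t ∂(g t)))
        + ∫ t in Set.Ioc (0:ℝ) tstar, collisionInt σ (g t) (φ t)

/-- The support of a measure on `ℝ`. -/
def msupport (μ : Measure ℝ) : Set ℝ :=
  {x : ℝ | ∀ r : ℝ, 0 < r → 0 < μ (Metric.ball x r)}

/-- The iterates `A₁ = A`, `A_{n+1} = (A_n + A_n - A_n) ∩ (0,∞)` (pointwise set operations). -/
def iterSet (A : Set ℝ) : ℕ → Set ℝ
  | 0 => A
  | n + 1 => (iterSet A n + iterSet A n - iterSet A n) ∩ Set.Ioi 0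

/-- The extended set `A*`. -/
def extSet (A : Set ℝ) : Set ℝ := ⋃ n : ℕ, iterSet A (n + 1)

/-- The collision weight `Φ₀(x,y,z) / √(xyz)`. -/
def collWeight (x y z : ℝ) : ℝ := PhiKer 0 x y z / √(x * y * z)

/-- The collision integrand tested against `ψ`. -/
def collTerm (ψ : ℝ → ℝ) (x y z : ℝ) : ℝ :=
  collWeight x y z * (ψ (x + y - z) + ψ z - ψ x - ψ y)

lemma PhiKer_nonneg (x y z : ℝ) : 0 ≤ PhiKer 0 x y z := by
  unfold PhiKer Phi4
  split_ifs
  · positivity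
  · exact le_rfl

lemma collWeight_nonneg (x y z : ℝ) : 0 ≤ collWeight x y z :=
  div_nonneg (PhiKer_nonneg x y z) (Real.sqrt_nonneg _)

lemma collWeight_comm (x y z : ℝ) : collWeight x y z = collWeight y x z := by
  unfold collWeight PhiKer Phi4
  rw [add_comm y x, mul_comm y x, min_comm (√(max (y - 0) 0)) (√(max (x - 0) 0))]

lemma collWeight_eq_zero {x y z : ℝ} (h : ¬ (0 < x ∧ 0 < y ∧ 0 < z ∧ 0 < x + y - z)) :
    collWeight x y z = 0 := by
  have key : PhiKer 0 x y z = 0 := by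
    apply le_antisymm _ (PhiKer_nonneg x y z)
    unfold PhiKer Phi4
    split_ifs with h0
    · simp only [sub_zero]
      by_cases hx : 0 < x
      · by_cases hy : 0 < y
        · by_cases hz : 0 < z
          · have hw : x + y - z ≤ 0 := by
              by_contra hw
              exact h ⟨hx, hy, hz, not_le.mp hw⟩
            refine (min_le_right _ _).trans ((min_le_right _ _).trans ?_)
            rw [max_eq_right hw, Real.sqrt_zero]
          · refine (min_le_right _ _).trans ((min_le_left _ _).trans ?_)
            rw [max_eq_right (not_lt.mp hz), Real.sqrt_zero]
        · refine (min_le_left _ _).trans ((min_le_right _ _).trans ?_)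
          rw [max_eq_right (not_lt.mp hy), Real.sqrt_zero]
      · refine (min_le_left _ _).trans ((min_le_left _ _).trans ?_)
        rw [max_eq_right (not_lt.mp hx), Real.sqrt_zero]
    · exact le_rfl
  unfold collWeight
  rw [key, zero_div]

lemma collWeight_of_pos {x y z : ℝ} (hx : 0 < x) (hy : 0 < y) (hz : 0 < z)
    (hw : 0 < x + y - z) :
    collWeight x y z = min (min √x √y) (min √z √(x + y - z)) / √(x * y * z) := by
  unfold collWeight PhiKer Phi4
  rw [if_pos hw.le]
  simp only [sub_zero, max_eq_left hx.le, max_eq_left hy.le, max_eq_left hz.le,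
    max_eq_left hw.le]

lemma collWeight_pos {x y z : ℝ} (hx : 0 < x) (hy : 0 < y) (hz : 0 < z)
    (hw : 0 < x + y - z) : 0 < collWeight x y z := by
  rw [collWeight_of_pos hx hy hz hw]
  positivity

lemma sqrt_div_sqrt_mul_mul {x y z : ℝ} (hx : 0 < x) (hy : 0 < y) (hz : 0 < z) :
    √z / √(x * y * z) = 1 / √(x * y) := by
  rw [Real.sqrt_mul (by positivity) z]
  have h1 : 0 < √z := Real.sqrt_pos.mpr hz
  have h2 : 0 < √(x * y) := Real.sqrt_pos.mpr (by positivity)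
  field_simp

lemma collWeight_le_left {x y z : ℝ} (hx : 0 < x) (hy : 0 < y) (hz : 0 < z) :
    collWeight x y z ≤ 1 / √(x * y) := by
  by_cases hw : 0 < x + y - z
  · rw [collWeight_of_pos hx hy hz hw, ← sqrt_div_sqrt_mul_mul hx hy hz]
    gcongr
    exact (min_le_right _ _).trans (min_le_left _ _)
  · rw [collWeight_eq_zero (fun h => hw h.2.2.2)]
    positivity

lemma collWeight_le_right {x y z : ℝ} (hx : 0 < x) (hy : 0 < y) (hz : 0 < z) :
    collWeight x y z ≤ 1 / √(x * z) := by
  by_cases hw : 0 < x + y - z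
  · rw [collWeight_of_pos hx hy hz hw, ← sqrt_div_sqrt_mul_mul hx hz hy, mul_right_comm x y z]
    gcongr
    exact (min_le_left _ _).trans (min_le_right _ _)
  · rw [collWeight_eq_zero (fun h => hw h.2.2.2)]
    positivity

lemma collWeight_eq_of_le {x y z : ℝ} (hz : 0 < z) (hx : z ≤ x) (hy : z ≤ y) :
    collWeight x y z = 1 / √(x * y) := by
  have hx0 := hz.trans_le hx
  have hy0 := hz.trans_le hy
  rw [collWeight_of_pos hx0 hy0 hz (by linarith), ← sqrt_div_sqrt_mul_mul hx0 hy0 hz]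
  congr 1
  rw [min_eq_left (Real.sqrt_le_sqrt (by linarith : z ≤ x + y - z)), min_eq_right]
  exact le_min (Real.sqrt_le_sqrt hx) (Real.sqrt_le_sqrt hy)

lemma collWeight_eq_of_le' {x y z : ℝ} (hz : 0 < z) (hzy : z ≤ y) (hyx : y ≤ x) :
    collWeight x z y = 1 / √(x * y) := by
  have hy0 := hz.trans_le hzy
  have hx0 := hy0.trans_le hyx
  rw [collWeight_of_pos hx0 hz hy0 (by linarith), ← sqrt_div_sqrt_mul_mul hx0 hy0 hz,
    mul_right_comm x z y]
  congr 1
  rw [min_eq_right (Real.sqrt_le_sqrt (hzy.trans hyx)), min_eq_left]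
  exact le_min (Real.sqrt_le_sqrt hzy) (Real.sqrt_le_sqrt (by linarith))

lemma mul_le_one_of_le_inv_sqrt {d p q k : ℝ} (hd : 0 ≤ d) (hp : 0 < p) (hdp : d ≤ p)
    (hdq : d ≤ q) (hk : k ≤ 1 / √(p * q)) : k * d ≤ 1 := by
  rcases hd.eq_or_lt with rfl | hd
  · simp
  have hq : 0 < q := hd.trans_le hdq
  have h1 : d ≤ √(p * q) := by
    apply Real.le_sqrt_of_sq_le
    nlinarith
  have h2 : 0 < √(p * q) := by positivity
  calc k * d ≤ 1 / √(p * q) * d := by gcongr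
    _ ≤ 1 / √(p * q) * √(p * q) := by gcongr
    _ = 1 := by field_simp

lemma abs_collTerm_le {ψ : ℝ → ℝ} {L : ℝ} (hL : 0 ≤ L)
    (hψ : ∀ u v : ℝ, 0 ≤ u → 0 ≤ v → |ψ u - ψ v| ≤ L * |u - v|) (x y z : ℝ) :
    |collTerm ψ x y z| ≤ 2 * L := by
  by_cases h : 0 < x ∧ 0 < y ∧ 0 < z ∧ 0 < x + y - z
  swap
  · rw [collTerm, collWeight_eq_zero h]
    simpa using hL
  obtain ⟨hx, hy, hz, hw⟩ := h
  wlog hxy : y ≤ x generalizing x y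
  · have := this y x hy hx (by linarith) (le_of_not_ge hxy)
    rw [collTerm, collWeight_comm, add_comm x y]
    rw [collTerm] at this
    convert this using 3
    ring
  have hk := collWeight_nonneg x y z
  have hB1 : |ψ (x + y - z) + ψ z - ψ x - ψ y| ≤ 2 * L * |x - z| := by
    have e1 := hψ (x + y - z) y hw.le hy.le
    have e2 := hψ z x hz.le hx.le
    rw [show x + y - z - y = x - z by ring] at e1
    rw [abs_sub_comm z x] at e2
    calc _ = |(ψ (x + y - z) - ψ y) + (ψ z - ψ x)| := by congr 1; ring
      _ ≤ _ := (abs_add_le _ _).trans (by linarith)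
  have hB2 : |ψ (x + y - z) + ψ z - ψ x - ψ y| ≤ 2 * L * |y - z| := by
    have e1 := hψ (x + y - z) x hw.le hx.le
    have e2 := hψ z y hz.le hy.le
    rw [show x + y - z - x = y - z by ring] at e1
    rw [abs_sub_comm z y] at e2
    calc _ = |(ψ (x + y - z) - ψ x) + (ψ z - ψ y)| := by congr 1; ring
      _ ≤ _ := (abs_add_le _ _).trans (by linarith)
  rw [collTerm, abs_mul, abs_of_nonneg hk]
  have fin : ∀ d : ℝ, |ψ (x + y - z) + ψ z - ψ x - ψ y| ≤ 2 * L * d →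
      collWeight x y z * d ≤ 1 →
      collWeight x y z * |ψ (x + y - z) + ψ z - ψ x - ψ y| ≤ 2 * L := by
    intro d h1 h2
    calc _ ≤ collWeight x y z * (2 * L * d) := by gcongr
      _ = 2 * L * (collWeight x y z * d) := by ring
      _ ≤ 2 * L * 1 := by gcongr
      _ = 2 * L := by ring
  rcases le_total z y with hzy | hyz
  · refine fin _ hB2 (mul_le_one_of_le_inv_sqrt (abs_nonneg _) hx ?_ ?_
      (collWeight_le_left hx hy hz)) <;> rw [abs_of_nonneg (by linarith)] <;> linarith
  rcases le_total z x with hzx | hxz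
  · refine fin _ hB2 (mul_le_one_of_le_inv_sqrt (abs_nonneg _) hx ?_ ?_
      (collWeight_le_right hx hy hz)) <;> rw [abs_of_nonpos (by linarith)] <;> linarith
  · refine fin _ hB1 (mul_le_one_of_le_inv_sqrt (abs_nonneg _) hx ?_ ?_
      (collWeight_le_left hx hy hz)) <;> rw [abs_of_nonpos (by linarith)] <;> linarith

lemma measurable_PhiKer : Measurable fun p : ℝ × ℝ × ℝ => PhiKer 0 p.1 p.2.1 p.2.2 := by
  unfold PhiKer Phi4
  refine Measurable.ite (measurableSet_le (by fun_prop) (by fun_prop)) ?_ (by fun_prop)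
  fun_prop

lemma measurable_collWeight :
    Measurable fun p : ℝ × ℝ × ℝ => collWeight p.1 p.2.1 p.2.2 := by
  unfold collWeight
  exact measurable_PhiKer.div (by fun_prop)

lemma measurable_collTerm {ψ : ℝ → ℝ} (hψ : Measurable ψ) :
    Measurable fun p : ℝ × ℝ × ℝ => collTerm ψ p.1 p.2.1 p.2.2 := by
  unfold collTerm
  exact measurable_collWeight.mul (by fun_prop)

/-- Sum of the collision integrand over the three choices of the outgoing variable. -/
def symTerm (ψ : ℝ → ℝ) (x y z : ℝ) : ℝ :=
  collTerm ψ x y z + collTerm ψ x z y + collTerm ψ y z x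

lemma collTerm_comm (ψ : ℝ → ℝ) (x y z : ℝ) : collTerm ψ x y z = collTerm ψ y x z := by
  rw [collTerm, collTerm, collWeight_comm, add_comm x y]
  ring

lemma ConvexOn.add_le_add_of_le {ψ : ℝ → ℝ} (hψ : ConvexOn ℝ univ ψ) {u x y v : ℝ}
    (hux : u ≤ x) (hxv : x ≤ v) (h : u + v = x + y) : ψ x + ψ y ≤ ψ u + ψ v := by
  rcases (hux.trans hxv).eq_or_lt with huv | huv
  · have h1 : x = u := by linarith
    have h2 : y = v := by linarith
    rw [h1, h2]
  have hd : 0 < v - u := by linarith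
  have ha : 0 ≤ (v - x) / (v - u) := div_nonneg (by linarith) hd.le
  have hb : 0 ≤ (x - u) / (v - u) := div_nonneg (by linarith) hd.le
  have e3 : (v - x) / (v - u) + (x - u) / (v - u) = 1 := by field_simp; ring
  have e1 := hψ.2 (mem_univ u) (mem_univ v) ha hb e3
  have e2 := hψ.2 (mem_univ u) (mem_univ v) hb ha (by rw [add_comm, e3])
  simp only [smul_eq_mul] at e1 e2
  rw [show (v - x) / (v - u) * u + (x - u) / (v - u) * v = x by field_simp; ring] at e1
  rw [show (x - u) / (v - u) * u + (v - x) / (v - u) * v = y by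
    rw [show y = u + v - x by linarith]; field_simp; ring] at e2
  have e4 : (v - x) / (v - u) * ψ u + (x - u) / (v - u) * ψ v
      + ((x - u) / (v - u) * ψ u + (v - x) / (v - u) * ψ v) = ψ u + ψ v := by
    linear_combination (ψ u + ψ v) * e3
  linarith

lemma le_symTerm_of_le {ψ : ℝ → ℝ} (hψ : ConvexOn ℝ univ ψ) {x y z : ℝ} (hz : 0 < z)
    (hzy : z ≤ y) (hyx : y ≤ x) :
    1 / √(x * y) * (ψ (x + (y - z)) + ψ (x - (y - z)) - 2 * ψ x) ≤ symTerm ψ x y z := by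
  have h3 : 0 ≤ collTerm ψ y z x := by
    apply mul_nonneg (collWeight_nonneg _ _ _)
    have := hψ.add_le_add_of_le (u := y + z - x) (x := y) (y := z) (v := x) (by linarith) hyx
      (by ring)
    linarith
  have h1 := collWeight_eq_of_le hz (hzy.trans hyx) hzy
  have h2 := collWeight_eq_of_le' hz hzy hyx
  have : collTerm ψ x y z + collTerm ψ x z y
      = 1 / √(x * y) * (ψ (x + (y - z)) + ψ (x - (y - z)) - 2 * ψ x) := by
    rw [collTerm, collTerm, h1, h2, show x + y - z = x + (y - z) by ring,
      show x + z - y = x - (y - z) by ring]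
    ring
  rw [symTerm]
  linarith

lemma symTerm_nonneg {ψ : ℝ → ℝ} (hψ : ConvexOn ℝ univ ψ) (x y z : ℝ) :
    0 ≤ symTerm ψ x y z := by
  by_cases h : 0 < x ∧ 0 < y ∧ 0 < z
  swap
  · have e1 : collWeight x y z = 0 := collWeight_eq_zero fun h' => h ⟨h'.1, h'.2.1, h'.2.2.1⟩
    have e2 : collWeight x z y = 0 := collWeight_eq_zero fun h' => h ⟨h'.1, h'.2.2.1, h'.2.1⟩
    have e3 : collWeight y z x = 0 := collWeight_eq_zero fun h' => h ⟨h'.2.2.1, h'.1, h'.2.1⟩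
    simp [symTerm, collTerm, e1, e2, e3]
  obtain ⟨hx, hy, hz⟩ := h
  have key : ∀ x y z : ℝ, 0 < z → z ≤ y → y ≤ x → 0 ≤ symTerm ψ x y z := by
    intro x y z hz hzy hyx
    refine le_trans (mul_nonneg (by positivity) ?_) (le_symTerm_of_le hψ hz hzy hyx)
    have := hψ.add_le_add_of_le (u := x - (y - z)) (x := x) (y := x) (v := x + (y - z))
      (by linarith) (by linarith) (by ring)
    linarith
  have s1 : symTerm ψ x y z = symTerm ψ y x z := by
    rw [symTerm, symTerm, collTerm_comm ψ x y z]; ring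
  have s2 : ∀ x y z, symTerm ψ x y z = symTerm ψ x z y := by
    intro x y z
    rw [symTerm, symTerm, collTerm_comm ψ y z x]; ring
  have s3 : ∀ x y z, symTerm ψ x y z = symTerm ψ y x z := by
    intro x y z
    rw [symTerm, symTerm, collTerm_comm ψ x y z]; ring
  rcases le_total y x with h1 | h1 <;> rcases le_total z y with h2 | h2 <;>
    rcases le_total z x with h3 | h3
  · exact key _ _ _ hz h2 h1
  · exact key _ _ _ hz h2 h1
  · rw [s2]; exact key _ _ _ hy h2 h3
  · rw [s2, s3]; exact key _ _ _ hy h1 h3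
  · rw [s3]; exact key _ _ _ hz h3 h1
  · rw [s3, s2]; exact key _ _ _ hx h3 h2
  · rw [s2, s3, s2]; exact key _ _ _ hx h1 (by linarith)
  · rw [s2, s3, s2]; exact key _ _ _ hx h1 h2

lemma collisionInt_eq_restrict (μ : Measure ℝ) (ψ : ℝ → ℝ) :
    collisionInt 0 μ ψ = collisionInt 0 (μ.restrict (Ioi 0)) ψ := by
  have hx : ∀ x y z : ℝ, ¬ (0 < x ∧ 0 < y ∧ 0 < z) → collTerm ψ x y z = 0 := by
    intro x y z h
    rw [collTerm, collWeight_eq_zero fun h' => h ⟨h'.1, h'.2.1, h'.2.2.1⟩, zero_mul]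
  change ∫ x, ∫ y, ∫ z, collTerm ψ x y z ∂μ ∂μ ∂μ = ∫ x in Ioi 0, ∫ y in Ioi 0, ∫ z in Ioi 0,
    collTerm ψ x y z ∂μ ∂μ ∂μ
  have e1 : ∀ x y, ∫ z in Ioi 0, collTerm ψ x y z ∂μ = ∫ z, collTerm ψ x y z ∂μ := fun x y =>
    setIntegral_eq_integral_of_forall_compl_eq_zero fun z hz => hx x y z fun h => hz h.2.2
  simp_rw [e1]
  have e2 : ∀ x, ∫ y in Ioi 0, ∫ z, collTerm ψ x y z ∂μ ∂μ
      = ∫ y, ∫ z, collTerm ψ x y z ∂μ ∂μ := fun x =>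
    setIntegral_eq_integral_of_forall_compl_eq_zero fun y hy => by
      simp [fun z => hx x y z fun h => hy h.2.1]
  simp_rw [e2]
  exact (setIntegral_eq_integral_of_forall_compl_eq_zero fun x hx' => by
      simp [fun y z => hx x y z fun h => hx' h.1]).symm

/-- A measurable function that is `L`-Lipschitz on `[0,∞)`. -/
structure IsLipTest (L : ℝ) (ψ : ℝ → ℝ) : Prop where
  nonneg : 0 ≤ L
  meas : Measurable ψ
  lip : ∀ u v : ℝ, 0 ≤ u → 0 ≤ v → |ψ u - ψ v| ≤ L * |u - v|

section FiniteMeasure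

variable {μ : Measure ℝ} [IsFiniteMeasure μ] {L : ℝ} {ψ : ℝ → ℝ}

lemma IsLipTest.integrable (hψ : IsLipTest L ψ) :
    Integrable (fun p : ℝ × ℝ × ℝ => collTerm ψ p.1 p.2.1 p.2.2) (μ.prod (μ.prod μ)) :=
  Integrable.of_bound (measurable_collTerm hψ.meas).aestronglyMeasurable (2 * L)
    (.of_forall fun _ => abs_collTerm_le hψ.nonneg hψ.lip _ _ _)

lemma collisionInt_eq_integral_prod (hψ : IsLipTest L ψ) :
    collisionInt 0 μ ψ = ∫ p, collTerm ψ p.1 p.2.1 p.2.2 ∂(μ.prod (μ.prod μ)) := by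
  change ∫ x, ∫ y, ∫ z, collTerm ψ x y z ∂μ ∂μ ∂μ = _
  rw [integral_prod _ hψ.integrable]
  congr 1
  ext x
  refine (integral_prod (fun p : ℝ × ℝ => collTerm ψ x p.1 p.2) ?_).symm
  exact Integrable.of_bound
    ((measurable_collTerm hψ.meas).comp measurable_prodMk_left).aestronglyMeasurable (2 * L)
    (.of_forall fun _ => abs_collTerm_le hψ.nonneg hψ.lip _ _ _)

lemma abs_collisionInt_le (hψ : IsLipTest L ψ) :
    |collisionInt 0 μ ψ| ≤ 2 * L * μ.real univ ^ 3 := by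
  rw [collisionInt_eq_integral_prod hψ, ← Real.norm_eq_abs]
  refine (norm_integral_le_of_norm_le_const
    (.of_forall fun p => abs_collTerm_le hψ.nonneg hψ.lip p.1 p.2.1 p.2.2)).trans (le_of_eq ?_)
  rw [← univ_prod_univ, measureReal_prod_prod, ← univ_prod_univ, measureReal_prod_prod]
  ring

lemma three_mul_collisionInt (hψ : IsLipTest L ψ) :
    Integrable (fun p : ℝ × ℝ × ℝ => symTerm ψ p.1 p.2.1 p.2.2) (μ.prod (μ.prod μ)) ∧
    3 * collisionInt 0 μ ψ = ∫ p, symTerm ψ p.1 p.2.1 p.2.2 ∂(μ.prod (μ.prod μ)) := by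
  have hi : Integrable (fun p : ℝ × ℝ × ℝ => collTerm ψ p.1 p.2.1 p.2.2)
    (μ.prod (μ.prod μ)) := hψ.integrable
  have m1 : MeasurePreserving (fun p : ℝ × ℝ × ℝ => (p.1, p.2.2, p.2.1))
      (μ.prod (μ.prod μ)) (μ.prod (μ.prod μ)) :=
    (MeasurePreserving.id μ).prod Measure.measurePreserving_swap
  have m2 : MeasurePreserving (fun p : ℝ × ℝ × ℝ => (p.2.1, p.2.2, p.1))
      (μ.prod (μ.prod μ)) (μ.prod (μ.prod μ)) :=
    (measurePreserving_prodAssoc μ μ μ).comp Measure.measurePreserving_swap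
  have i1 : Integrable (fun p : ℝ × ℝ × ℝ => collTerm ψ p.1 p.2.2 p.2.1)
    (μ.prod (μ.prod μ)) := m1.integrable_comp_of_integrable hi
  have i2 : Integrable (fun p : ℝ × ℝ × ℝ => collTerm ψ p.2.1 p.2.2 p.1)
    (μ.prod (μ.prod μ)) := m2.integrable_comp_of_integrable hi
  have i12 : Integrable (fun p : ℝ × ℝ × ℝ => collTerm ψ p.1 p.2.1 p.2.2
    + collTerm ψ p.1 p.2.2 p.2.1) (μ.prod (μ.prod μ)) := hi.add i1
  have e : ∀ F : ℝ × ℝ × ℝ → ℝ × ℝ × ℝ,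
      MeasurePreserving F (μ.prod (μ.prod μ)) (μ.prod (μ.prod μ)) →
      ∫ p, collTerm ψ (F p).1 (F p).2.1 (F p).2.2 ∂(μ.prod (μ.prod μ)) = collisionInt 0 μ ψ := by
    intro F hF
    rw [collisionInt_eq_integral_prod hψ]
    conv_rhs => rw [← hF.map_eq]
    exact (integral_map hF.measurable.aemeasurable
      (measurable_collTerm hψ.meas).aestronglyMeasurable).symm
  refine ⟨i12.add i2, ?_⟩
  unfold symTerm
  rw [integral_add i12 i2, integral_add hi i1, ← collisionInt_eq_integral_prod hψ]
  have e1 := e _ m1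
  have e2 := e _ m2
  simp only at e1 e2
  rw [e1, e2]
  ring

lemma collisionInt_nonneg (hψ : IsLipTest L ψ) (hc : ConvexOn ℝ univ ψ) :
    0 ≤ collisionInt 0 μ ψ := by
  have h := (three_mul_collisionInt (μ := μ) hψ).2
  have : 0 ≤ ∫ p, symTerm ψ p.1 p.2.1 p.2.2 ∂(μ.prod (μ.prod μ)) :=
    integral_nonneg fun _ => symTerm_nonneg hc _ _ _
  linarith

end FiniteMeasure

lemma hasDerivAt_max_zero_pow (n : ℕ) (x : ℝ) :
    HasDerivAt (fun x : ℝ => max x 0 ^ (n + 2)) ((n + 2) * max x 0 ^ (n + 1)) x := by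
  rcases lt_trichotomy x 0 with hx | rfl | hx
  · rw [max_eq_right hx.le, zero_pow (by omega), mul_zero]
    refine (hasDerivAt_const x (0 : ℝ)).congr_of_eventuallyEq ?_
    filter_upwards [Iio_mem_nhds hx] with y hy
    rw [max_eq_right (le_of_lt hy), zero_pow (by omega)]
  · rw [max_self, zero_pow (by omega), mul_zero, hasDerivAt_iff_isLittleO_nhds_zero]
    have h1 : (fun h : ℝ => max h 0 ^ (n + 2)) =O[nhds 0] fun h => h ^ (n + 2) := by
      refine Asymptotics.IsBigO.of_bound 1 (.of_forall fun h => ?_)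
      rw [one_mul, norm_pow, norm_pow]
      gcongr
      rw [Real.norm_eq_abs, Real.norm_eq_abs, abs_of_nonneg (le_max_right _ _)]
      exact max_le (le_abs_self h) (abs_nonneg h)
    have h2 : (fun h : ℝ => h ^ (n + 2)) =o[nhds 0] fun h : ℝ => h := by
      simpa using Asymptotics.isLittleO_pow_pow (𝕜 := ℝ) (show 1 < n + 2 by omega)
    simpa using h1.trans_isLittleO h2
  · rw [max_eq_left hx.le]
    have := hasDerivAt_pow (n + 2) x
    push_cast at this
    refine this.congr_of_eventuallyEq ?_
    filter_upwards [Ioi_mem_nhds hx] with y hy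
    rw [max_eq_left (le_of_lt hy)]

lemma contDiff_max_zero_pow : ContDiff ℝ 2 fun x : ℝ => max x 0 ^ 3 := by
  have d1 : deriv (fun x : ℝ => max x 0 ^ 3) = fun x => 3 * max x 0 ^ 2 := by
    ext x
    have := (hasDerivAt_max_zero_pow 1 x).deriv
    norm_num at this
    exact this
  have d2 : deriv (fun x : ℝ => 3 * max x 0 ^ 2) = fun x => 3 * (2 * max x 0) := by
    ext x
    have h0 : HasDerivAt (fun x : ℝ => max x 0 ^ 2) (2 * max x 0) x := by
      simpa using hasDerivAt_max_zero_pow 0 x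
    exact (h0.const_mul 3).deriv
  rw [show (2 : WithTop ℕ∞) = 1 + 1 by norm_num, contDiff_succ_iff_deriv]
  refine ⟨fun x => (hasDerivAt_max_zero_pow 1 x).differentiableAt, by simp, ?_⟩
  rw [d1, show (1 : WithTop ℕ∞) = 0 + 1 by norm_num, contDiff_succ_iff_deriv]
  refine ⟨fun x => ((hasDerivAt_max_zero_pow 0 x).const_mul 3).differentiableAt, by simp, ?_⟩
  rw [d2, contDiff_zero]
  fun_prop

/-- The convex truncation `(1 - ω/R)₊³`. -/
def trunc (R ω : ℝ) : ℝ := max (1 - ω / R) 0 ^ 3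

lemma contDiff_trunc (R : ℝ) : ContDiff ℝ 2 (trunc R) :=
  contDiff_max_zero_pow.comp (by fun_prop)

lemma trunc_nonneg (R ω : ℝ) : 0 ≤ trunc R ω := by unfold trunc; positivity

lemma trunc_le_one {R ω : ℝ} (hR : 0 < R) (hω : 0 ≤ ω) : trunc R ω ≤ 1 := by
  have : 0 ≤ ω / R := by positivity
  exact pow_le_one₀ (le_max_right _ _) (max_le (by linarith) zero_le_one)

lemma trunc_eq_zero {R ω : ℝ} (hR : 0 < R) (h : R ≤ ω) : trunc R ω = 0 := by
  have : 1 ≤ ω / R := by rwa [le_div_iff₀ hR, one_mul]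
  rw [trunc, max_eq_right (by linarith)]
  norm_num

lemma trunc_anti {R : ℝ} (hR : 0 < R) {a b : ℝ} (h : a ≤ b) : trunc R b ≤ trunc R a := by
  unfold trunc
  gcongr

lemma trunc_of_le {R ω : ℝ} (hR : 0 < R) (h : ω ≤ R) : trunc R ω = (1 - ω / R) ^ 3 := by
  have : ω / R ≤ 1 := by rwa [div_le_one hR]
  rw [trunc, max_eq_left (by linarith)]

lemma convexOn_trunc (R : ℝ) : ConvexOn ℝ univ (trunc R) := by
  have h1 : ConvexOn ℝ univ fun ω : ℝ => max (1 - ω / R) 0 := by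
    refine ConvexOn.sup ⟨convex_univ, ?_⟩ (convexOn_const 0 convex_univ)
    intro x _ y _ a b _ _ hab
    simp only [smul_eq_mul]
    apply le_of_eq
    linear_combination -hab
  exact h1.pow (fun x _ => le_max_right _ _) 3

lemma isLipTest_trunc {R : ℝ} (hR : 0 < R) : IsLipTest (3 / R) (trunc R) := by
  refine ⟨by positivity, (contDiff_trunc R).continuous.measurable, fun u v hu hv => ?_⟩
  have h0 : ∀ w : ℝ, 0 ≤ w → max (1 - w / R) 0 ≤ 1 := fun w hw => by
    have : 0 ≤ w / R := by positivity
    exact max_le (by linarith) zero_le_one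
  have h1 : |max (1 - u / R) 0 - max (1 - v / R) 0| ≤ |u - v| / R := by
    refine (abs_max_sub_max_le_abs _ _ _).trans (le_of_eq ?_)
    rw [show 1 - u / R - (1 - v / R) = -((u - v) / R) by ring, abs_neg, abs_div, abs_of_pos hR]
  unfold trunc
  set p := max (1 - u / R) 0
  set q := max (1 - v / R) 0
  have hp : 0 ≤ p := le_max_right _ _
  have hq : 0 ≤ q := le_max_right _ _
  have hp1 := h0 u hu
  have hq1 := h0 v hv
  rw [show p ^ 3 - q ^ 3 = (p - q) * (p ^ 2 + p * q + q ^ 2) by ring, abs_mul,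
    abs_of_nonneg (show 0 ≤ p ^ 2 + p * q + q ^ 2 by positivity)]
  calc |p - q| * (p ^ 2 + p * q + q ^ 2) ≤ |u - v| / R * 3 := by
        gcongr
        nlinarith
    _ = _ := by ring

lemma trunc_second_difference {r a h : ℝ} (hr : 0 < r) (har : a ≤ r)
    (h0 : 0 ≤ h) (hh : h ≤ a) :
    h ^ 2 / (4 * r ^ 2) ≤
      trunc (4 * r) (a + h) + trunc (4 * r) (a - h) - 2 * trunc (4 * r) a := by
  have hR : 0 < 4 * r := by linarith
  rw [trunc_of_le hR (by linarith), trunc_of_le hR (by linarith), trunc_of_le hR (by linarith)]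
  have e : (1 - (a + h) / (4 * r)) ^ 3 + (1 - (a - h) / (4 * r)) ^ 3
      - 2 * (1 - a / (4 * r)) ^ 3 = 6 * (1 - a / (4 * r)) * h ^ 2 / (16 * r ^ 2) := by
    field_simp
    ring
  have h2 : a / (4 * r) ≤ 1 / 4 := by
    rw [div_le_iff₀ hR]; linarith
  rw [e, show h ^ 2 / (4 * r ^ 2) = 4 * h ^ 2 / (16 * r ^ 2) by field_simp; ring]
  gcongr
  linarith

lemma symTerm_comm (ψ : ℝ → ℝ) (x y z : ℝ) : symTerm ψ x y z = symTerm ψ y x z := by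
  rw [symTerm, symTerm, collTerm_comm ψ x y z]
  ring

lemma le_symTerm_trunc {r β x y z : ℝ} (hr : 0 < r) (hβ : 0 ≤ β) (hz : 0 < z) (hxr : x ≤ r)
    (hyr : y ≤ r) (hx : z + β * r ≤ x) (hy : z + β * r ≤ y) :
    β ^ 2 / (4 * r) ≤ symTerm (trunc (4 * r)) x y z := by
  wlog hxy : y ≤ x generalizing x y
  · rw [symTerm_comm]
    exact this hyr hxr hy hx (le_of_not_ge hxy)
  have hβr : 0 ≤ β * r := by positivity
  refine le_trans ?_ (le_symTerm_of_le (convexOn_trunc _) hz (by linarith) hxy)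
  have h1 := trunc_second_difference (a := x) (h := y - z) hr hxr (by linarith) (by linarith)
  have h2 : 1 / r ≤ 1 / √(x * y) := by
    have hx0 : 0 < x := by linarith
    have hy0 : 0 < y := by linarith
    apply one_div_le_one_div_of_le (by positivity)
    rw [Real.sqrt_le_left hr.le]
    nlinarith
  have h3 : (β * r) ^ 2 ≤ (y - z) ^ 2 := by
    apply pow_le_pow_left₀ hβr
    linarith
  calc β ^ 2 / (4 * r) = 1 / r * ((β * r) ^ 2 / (4 * r ^ 2)) := by field_simp
    _ ≤ 1 / r * ((y - z) ^ 2 / (4 * r ^ 2)) := by gcongr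
    _ ≤ _ := by
      apply mul_le_mul h2 h1 (by positivity) (by positivity)

lemma le_collisionInt_trunc {μ : Measure ℝ} [IsFiniteMeasure μ] {r β : ℝ} (hr : 0 < r)
    (hβ : 0 ≤ β) {J K : Set ℝ} (hJ : MeasurableSet J) (hK : MeasurableSet K)
    (hJr : ∀ y ∈ J, y ≤ r) (hK0 : ∀ z ∈ K, 0 < z) (hJK : ∀ y ∈ J, ∀ z ∈ K, z + β * r ≤ y) :
    β ^ 2 * μ.real J ^ 2 * μ.real K ≤ 12 * r * collisionInt 0 μ (trunc (4 * r)) := by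
  obtain ⟨hi, he⟩ := three_mul_collisionInt (μ := μ)
    (isLipTest_trunc (show 0 < 4 * r by linarith))
  have h1 : ∫ p, (J ×ˢ (J ×ˢ K)).indicator (fun _ => β ^ 2 / (4 * r)) p ∂(μ.prod (μ.prod μ)) ≤
      ∫ p, symTerm (trunc (4 * r)) p.1 p.2.1 p.2.2 ∂(μ.prod (μ.prod μ)) := by
    refine integral_mono ((integrable_const _).indicator (hJ.prod (hJ.prod hK))) hi fun p => ?_
    by_cases hp : p ∈ J ×ˢ (J ×ˢ K)
    · rw [indicator_of_mem hp]
      exact le_symTerm_trunc hr hβ (hK0 _ hp.2.2) (hJr _ hp.1) (hJr _ hp.2.1)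
        (hJK _ hp.1 _ hp.2.2) (hJK _ hp.2.1 _ hp.2.2)
    · rw [indicator_of_notMem hp]
      exact symTerm_nonneg (convexOn_trunc _) _ _ _
  rw [integral_indicator_const _ (hJ.prod (hJ.prod hK)), measureReal_prod_prod,
    measureReal_prod_prod, ← he, smul_eq_mul] at h1
  have h2 : 4 * r * (μ.real J * (μ.real J * μ.real K) * (β ^ 2 / (4 * r)))
      = β ^ 2 * μ.real J ^ 2 * μ.real K := by
    field_simp
  have h3 := mul_le_mul_of_nonneg_left h1 (show 0 ≤ 4 * r by linarith)
  linarith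

lemma collisionInt_eq_mul {μ : Measure ℝ} {ψ ψ' : ℝ → ℝ} {c : ℝ}
    (h : ∀ ω : ℝ, 0 < ω → ψ' ω = c * ψ ω) :
    collisionInt 0 μ ψ' = c * collisionInt 0 μ ψ := by
  have key : ∀ x y z, collTerm ψ' x y z = c * collTerm ψ x y z := by
    intro x y z
    by_cases hp : 0 < x ∧ 0 < y ∧ 0 < z ∧ 0 < x + y - z
    · rw [collTerm, collTerm, h _ hp.1, h _ hp.2.1, h _ hp.2.2.1, h _ hp.2.2.2]
      ring
    · rw [collTerm, collTerm, collWeight_eq_zero hp]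
      ring
  change ∫ x, ∫ y, ∫ z, collTerm ψ' x y z ∂μ ∂μ ∂μ = c * ∫ x, ∫ y, ∫ z, collTerm ψ x y z ∂μ ∂μ ∂μ
  simp_rw [key, integral_const_mul]

lemma integral_congr_of_nonneg {μ : Measure ℝ} (hμ : μ (Iio 0) = 0) {ψ ψ' : ℝ → ℝ}
    (h : ∀ ω : ℝ, 0 ≤ ω → ψ' ω = ψ ω) : ∫ ω, ψ' ω ∂μ = ∫ ω, ψ ω ∂μ := by
  refine integral_congr_ae ?_
  have : ∀ᵐ ω ∂μ, ω ∉ Iio 0 := measure_eq_zero_iff_ae_notMem.mp hμ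
  filter_upwards [this] with ω hω
  exact h ω (not_lt.mp hω)

lemma exists_cutoff (K : ℝ) : ∃ χ : ℝ → ℝ, ContDiff ℝ 2 χ ∧ HasCompactSupport χ ∧
    ∀ x : ℝ, |x| ≤ K → χ x = 1 := by
  let b : ContDiffBump (0 : ℝ) := ⟨|K| + 1, |K| + 2, by positivity, by linarith⟩
  refine ⟨b, b.contDiff, b.hasCompactSupport, fun x hx => b.one_of_mem_closedBall ?_⟩
  rw [mem_closedBall_zero_iff, Real.norm_eq_abs]
  change |x| ≤ |K| + 1
  linarith [le_abs_self K]

section WeakSolution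

variable {ρ : ℝ} {gin : Measure ℝ} {g : ℝ → Measure ℝ}

lemma IsWeakSolution.weak_form (hg : IsWeakSolution ρ 0 gin g) {θ ψ : ℝ → ℝ}
    (hθ : ContDiff ℝ 2 θ) (hψ : ContDiff ℝ 2 ψ) {R : ℝ} (hR : ∀ ω, R ≤ ω → ψ ω = 0) {T : ℝ}
    (hT : 0 ≤ T) :
    θ T * ∫ ω, ψ ω ∂(g T) - θ 0 * ∫ ω, ψ ω ∂gin =
      (∫ t in Ioc 0 T, deriv θ t * ∫ ω, ψ ω ∂(g t)) +
        ∫ t in Ioc 0 T, θ t * collisionInt 0 (g t) ψ := by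
  obtain ⟨χ, hχ, hχc, hχ1⟩ := exists_cutoff (T + 1)
  obtain ⟨ξ, hξ, hξc, hξ1⟩ := exists_cutoff R
  have hξψ : ∀ ω : ℝ, 0 ≤ ω → ξ ω * ψ ω = ψ ω := by
    intro ω hω
    rcases le_total R ω with h | h
    · rw [hR ω h, mul_zero]
    · rw [hξ1 ω (by rwa [abs_of_nonneg hω]), one_mul]
  obtain ⟨hmem, -, h0, hweak⟩ := hg
  have hint : ∀ t, 0 ≤ t → ∫ ω, ξ ω * ψ ω ∂(g t) = ∫ ω, ψ ω ∂(g t) := fun t ht =>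
    integral_congr_of_nonneg (hmem t ht).1 hξψ
  let φ : ℝ → ℝ → ℝ := fun t ω => (χ t * θ t) * (ξ ω * ψ ω)
  have htest : IsTestFun φ := by
    constructor
    · exact ((hχ.comp contDiff_fst).mul (hθ.comp contDiff_fst)).mul
        ((hξ.comp contDiff_snd).mul (hψ.comp contDiff_snd))
    · refine HasCompactSupport.intro (hχc.isCompact.prod hξc.isCompact) fun p hp => ?_
      rw [mem_prod, not_and_or] at hp
      change (χ p.1 * θ p.1) * (ξ p.2 * ψ p.2) = 0
      rcases hp with hp | hp
      · rw [image_eq_zero_of_notMem_tsupport hp]; ring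
      · rw [image_eq_zero_of_notMem_tsupport hp]; ring
  have key := hweak φ htest T hT
  have hχT : ∀ t, 0 ≤ t → t ≤ T → χ t = 1 := fun t h h' => hχ1 t (by
    rw [abs_of_nonneg h]; linarith)
  have e1 : ∀ t, 0 ≤ t → t ≤ T → ∫ ω, φ t ω ∂(g t) = θ t * ∫ ω, ψ ω ∂(g t) := by
    intro t h h'
    change ∫ ω, (χ t * θ t) * (ξ ω * ψ ω) ∂(g t) = _
    rw [integral_const_mul, hint t h, hχT t h h', one_mul]
  have e2 : ∀ t ∈ Ioc 0 T, ∫ ω, deriv (fun s => φ s ω) t ∂(g t)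
      = deriv θ t * ∫ ω, ψ ω ∂(g t) := by
    intro t ht
    have hd : deriv (fun s => χ s * θ s) t = deriv θ t := by
      apply Filter.EventuallyEq.deriv_eq
      filter_upwards [Ioo_mem_nhds ht.1 (show t < T + 1 by linarith [ht.2])] with s hs
      rw [hχ1 s (by rw [abs_of_pos hs.1]; exact hs.2.le), one_mul]
    have : ∀ ω, deriv (fun s => φ s ω) t = deriv θ t * (ξ ω * ψ ω) := fun ω => by
      rw [← hd]
      exact deriv_mul_const_field _
    simp_rw [this]
    rw [integral_const_mul, hint t ht.1.le]
  have e3 : ∀ t ∈ Ioc 0 T, collisionInt 0 (g t) (φ t) = θ t * collisionInt 0 (g t) ψ := by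
    intro t ht
    refine collisionInt_eq_mul fun ω hω => ?_
    change (χ t * θ t) * (ξ ω * ψ ω) = _
    rw [hξψ ω hω.le, hχT t ht.1.le ht.2, one_mul]
  have h00 := e1 0 le_rfl hT
  rw [h0] at h00
  rw [e1 T hT le_rfl, h00, setIntegral_congr_fun measurableSet_Ioc e2,
    setIntegral_congr_fun measurableSet_Ioc e3] at key
  exact key

lemma IsWeakSolution.weak_form_const (hg : IsWeakSolution ρ 0 gin g) {ψ : ℝ → ℝ}
    (hψ : ContDiff ℝ 2 ψ) {R : ℝ} (hR : ∀ ω, R ≤ ω → ψ ω = 0) {T : ℝ} (hT : 0 ≤ T) :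
    ∫ ω, ψ ω ∂(g T) - ∫ ω, ψ ω ∂gin = ∫ t in Ioc 0 T, collisionInt 0 (g t) ψ := by
  simpa using hg.weak_form (θ := fun _ => 1) contDiff_const hψ hR hT

lemma IsWeakSolution.continuousOn_integral (hg : IsWeakSolution ρ 0 gin g) {ψ : ℝ → ℝ}
    (hψ : Continuous ψ) {R : ℝ} (hR : ∀ ω, R ≤ ω → ψ ω = 0) :
    ContinuousOn (fun t => ∫ ω, ψ ω ∂(g t)) (Ici 0) := by
  obtain ⟨ξ, hξ, hξc, hξ1⟩ := exists_cutoff R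
  have hξψ : ∀ ω : ℝ, 0 ≤ ω → ξ ω * ψ ω = ψ ω := by
    intro ω hω
    rcases le_total R ω with h | h
    · rw [hR ω h, mul_zero]
    · rw [hξ1 ω (by rwa [abs_of_nonneg hω]), one_mul]
  refine (hg.2.1 (fun ω => ξ ω * ψ ω) (hξ.continuous.mul hψ) hξc.mul_right).congr ?_
  exact fun t ht => (integral_congr_of_nonneg (hg.1 t ht).1 hξψ).symm

/-- Dyadic decay with `ρ < -1` bounds the mass away from the origin. -/
lemma MemMplus.isFiniteMeasure_restrict (hρ : ρ < -1) {μ : Measure ℝ} (h : MemMplus ρ μ) :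
    IsFiniteMeasure (μ.restrict (Ioi 0)) := by
  obtain ⟨-, C, hC⟩ := h
  set C' := max C 0
  have hC' : 0 ≤ C' := le_max_right _ _
  have hbound : ∀ R : ℝ, 0 < R →
      μ (Icc (R / 2) R) ≤ ENNReal.ofReal (C' * (1 + R) ^ ρ * R) := fun R hR =>
    (hC R hR).trans (ENNReal.ofReal_le_ofReal (by
      gcongr
      exact le_max_left _ _))
  constructor
  rw [Measure.restrict_apply_univ]
  let q : ℝ := 2 ^ (ρ + 1)
  have hq0 : 0 < q := by positivity
  have hq1 : q < 1 := Real.rpow_lt_one_of_one_lt_of_neg (by norm_num) (by linarith)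
  have hcov : Ioi (0 : ℝ) ⊆ (⋃ n : ℕ, Icc ((1 / 2 : ℝ) ^ n / 2) ((1 / 2 : ℝ) ^ n)) ∪
      ⋃ n : ℕ, Icc ((2 : ℝ) ^ n / 2) ((2 : ℝ) ^ n) := by
    intro x hx
    rcases le_total x 1 with h1 | h1
    · left
      obtain ⟨n, hn, hn'⟩ := exists_nat_pow_near_of_lt_one (y := 1 / 2) hx h1 (by norm_num)
        (by norm_num)
      exact mem_iUnion.mpr ⟨n, by rw [pow_succ] at hn; linarith, hn'⟩
    · right
      obtain ⟨n, hn, hn'⟩ := exists_nat_pow_near h1 (y := 2) (by norm_num)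
      refine mem_iUnion.mpr ⟨n + 1, ?_, hn'.le⟩
      rw [pow_succ]
      linarith
  have hsmall : μ (⋃ n : ℕ, Icc ((1 / 2 : ℝ) ^ n / 2) ((1 / 2 : ℝ) ^ n)) < ⊤ := by
    refine (measure_iUnion_le _).trans_lt ?_
    have hle : ∀ n : ℕ, μ (Icc ((1 / 2 : ℝ) ^ n / 2) ((1 / 2 : ℝ) ^ n)) ≤
        ENNReal.ofReal (C' * (1 / 2) ^ n) := fun n => by
      refine (hbound _ (by positivity)).trans (ENNReal.ofReal_le_ofReal ?_)
      have : (1 + (1 / 2 : ℝ) ^ n) ^ ρ ≤ 1 :=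
        Real.rpow_le_one_of_one_le_of_nonpos (by
          have : 0 < (1 / 2 : ℝ) ^ n := by positivity
          linarith) (by linarith)
      calc C' * (1 + (1 / 2 : ℝ) ^ n) ^ ρ * (1 / 2) ^ n ≤ C' * 1 * (1 / 2) ^ n := by gcongr
        _ = _ := by ring
    refine (ENNReal.tsum_le_tsum hle).trans_lt ?_
    rw [← ENNReal.ofReal_tsum_of_nonneg (fun n => by positivity)
      (summable_geometric_two.mul_left C')]
    exact ENNReal.ofReal_lt_top
  have hlarge : μ (⋃ n : ℕ, Icc ((2 : ℝ) ^ n / 2) ((2 : ℝ) ^ n)) < ⊤ := by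
    refine (measure_iUnion_le _).trans_lt ?_
    have hle : ∀ n : ℕ, μ (Icc ((2 : ℝ) ^ n / 2) ((2 : ℝ) ^ n)) ≤
        ENNReal.ofReal (C' * q ^ n) := fun n => by
      refine (hbound _ (by positivity)).trans (ENNReal.ofReal_le_ofReal ?_)
      have h2 : (0 : ℝ) < 2 ^ n := by positivity
      have : (1 + (2 : ℝ) ^ n) ^ ρ ≤ (2 ^ n) ^ ρ :=
        Real.rpow_le_rpow_of_nonpos h2 (by linarith) (by linarith)
      calc C' * (1 + (2 : ℝ) ^ n) ^ ρ * 2 ^ n ≤ C' * (2 ^ n) ^ ρ * 2 ^ n := by gcongr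
        _ = C' * q ^ n := by
          rw [mul_assoc, ← Real.rpow_add_one h2.ne', ← Real.rpow_natCast 2 n,
            ← Real.rpow_mul (by norm_num), ← Real.rpow_natCast q n,
            ← Real.rpow_mul (by norm_num), mul_comm (n : ℝ)]
    refine (ENNReal.tsum_le_tsum hle).trans_lt ?_
    rw [← ENNReal.ofReal_tsum_of_nonneg (fun n => by positivity)
      ((summable_geometric_of_lt_one hq0.le hq1).mul_left C')]
    exact ENNReal.ofReal_lt_top
  exact (measure_mono hcov).trans_lt ((measure_union_le _ _).trans_lt
    (ENNReal.add_lt_top.mpr ⟨hsmall, hlarge⟩))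

lemma IsWeakSolution.collisionInt_nonneg (hg : IsWeakSolution ρ 0 gin g) (hρ : ρ < -1) {L : ℝ}
    {ψ : ℝ → ℝ} (hψ : IsLipTest L ψ) (hc : ConvexOn ℝ univ ψ) {t : ℝ} (ht : 0 ≤ t) :
    0 ≤ collisionInt 0 (g t) ψ := by
  have := (hg.1 t ht).isFiniteMeasure_restrict hρ
  rw [collisionInt_eq_restrict]
  exact _root_.collisionInt_nonneg hψ hc

lemma IsWeakSolution.integral_trunc_init_le (hg : IsWeakSolution ρ 0 gin g) (hρ : ρ < -1) {R : ℝ}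
    (hR : 0 < R) {T : ℝ} (hT : 0 ≤ T) :
    ∫ ω, trunc R ω ∂gin ≤ ∫ ω, trunc R ω ∂(g T) := by
  have h := hg.weak_form_const (contDiff_trunc R) (fun ω => trunc_eq_zero hR) hT
  have : 0 ≤ ∫ t in Ioc 0 T, collisionInt 0 (g t) (trunc R) :=
    setIntegral_nonneg measurableSet_Ioc fun t ht =>
      hg.collisionInt_nonneg hρ (isLipTest_trunc hR) (convexOn_trunc R) ht.1.le
  linarith

/-- Comparison in time between the truncated masses. -/
lemma IsWeakSolution.integral_trunc_mono (hg : IsWeakSolution ρ 0 gin g) (hρ : ρ < -1) {R : ℝ}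
    (hR : 0 < R) {s t : ℝ} (hs : 0 ≤ s) (hst : s ≤ t) :
    ∫ ω, trunc R ω ∂(g s) ≤ ∫ ω, trunc R ω ∂(g t) := by
  set F : ℝ → ℝ := fun t => ∫ ω, trunc R ω ∂(g t) with hF
  set f : ℝ → ℝ := fun t => collisionInt 0 (g t) (trunc R)
  have hcont : ContinuousOn F (Ici 0) :=
    hg.continuousOn_integral (contDiff_trunc R).continuous (fun ω => trunc_eq_zero hR)
  have hf : ∀ t, 0 ≤ t → 0 ≤ f t := fun t ht =>
    hg.collisionInt_nonneg hρ (isLipTest_trunc hR) (convexOn_trunc R) ht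
  have hweak : ∀ t, 0 ≤ t → F t - F 0 = ∫ τ in Ioc 0 t, f τ := by
    intro t ht
    rw [hF]
    simp only
    rw [hg.2.2.1]
    exact hg.weak_form_const (contDiff_trunc R) (fun ω => trunc_eq_zero hR) ht
  have hint : ∀ t, 0 ≤ t → F 0 < F t → IntegrableOn f (Ioc 0 t) := by
    intro t ht h
    by_contra hni
    have := hweak t ht
    rw [integral_undef hni] at this
    linarith
  have hmono : ∀ a b, 0 ≤ a → a ≤ b → F 0 < F b → F a ≤ F b := by
    intro a b ha hab hb
    have h1 := hweak a ha
    have h2 := hweak b (ha.trans hab)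
    have h3 : ∫ τ in Ioc 0 a, f τ ≤ ∫ τ in Ioc 0 b, f τ := by
      refine setIntegral_mono_set (hint b (ha.trans hab) hb) ?_
        (Ioc_subset_Ioc_right hab).eventuallyLE
      exact (ae_restrict_iff' measurableSet_Ioc).mpr (.of_forall fun x hx => hf x hx.1.le)
    linarith
  by_contra! hlt
  change F t < F s at hlt
  have h0t : F 0 ≤ F t := by
    simp only [hF]
    rw [hg.2.2.1]
    exact hg.integral_trunc_init_le hρ hR (hs.trans hst)
  have hK : IsCompact (Icc s t ∩ F ⁻¹' Ici (F s)) := by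
    refine isCompact_Icc.of_isClosed_subset ?_ inter_subset_left
    exact (hcont.mono fun x hx => hs.trans hx.1).preimage_isClosed_of_isClosed isClosed_Icc
      isClosed_Ici
  obtain ⟨c, ⟨⟨hsc, hct⟩, hcF⟩, hmax⟩ := hK.exists_isGreatest
    ⟨s, ⟨le_rfl, hst⟩, (le_rfl : F s ≤ F s)⟩
  have hcF : F s ≤ F c := hcF
  have hct' : c < t := lt_of_le_of_ne hct (by rintro rfl; linarith)
  have hc0 : 0 ≤ c := hs.trans hsc
  have hcc : Tendsto F (nhdsWithin c (Ioi c)) (nhds (F c)) :=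
    (hcont c hc0).mono_left (nhdsWithin_mono _ fun x hx => hc0.trans (le_of_lt hx))
  have hev := hcc.eventually (Ioi_mem_nhds (show F 0 < F c by linarith))
  obtain ⟨d, hd1, hd2⟩ := (hev.and (Ioo_mem_nhdsGT hct')).exists
  have h5 := hmono c d hc0 hd2.1.le hd1
  exact absurd (hmax ⟨⟨hsc.trans hd2.1.le, hd2.2.le⟩, hcF.trans h5⟩) (not_le.mpr hd2.1)

end WeakSolution

lemma integrable_trunc {μ : Measure ℝ} [IsFiniteMeasure μ] (hμ : μ (Iio 0) = 0) {R : ℝ}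
    (hR : 0 < R) : Integrable (trunc R) μ := by
  refine Integrable.of_bound (contDiff_trunc R).continuous.aestronglyMeasurable 1 ?_
  filter_upwards [measure_eq_zero_iff_ae_notMem.mp hμ] with ω hω
  rw [Real.norm_eq_abs, abs_of_nonneg (trunc_nonneg _ _)]
  exact trunc_le_one hR (not_lt.mp hω)

lemma tendsto_integral_trunc_atTop {μ : Measure ℝ} [IsFiniteMeasure μ] (hμ : μ (Iio 0) = 0) :
    Tendsto (fun R : ℝ => ∫ ω, trunc R ω ∂μ) atTop (nhds (μ.real univ)) := by
  have hae : ∀ᵐ ω ∂μ, ω ∉ Iio 0 := measure_eq_zero_iff_ae_notMem.mp hμ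
  have : μ.real univ = ∫ _, (1 : ℝ) ∂μ := by simp
  rw [this]
  refine tendsto_integral_filter_of_dominated_convergence (fun _ => 1)
    (.of_forall fun R => (contDiff_trunc R).continuous.aestronglyMeasurable) ?_
    (integrable_const _) ?_
  · filter_upwards [eventually_gt_atTop 0] with R hR
    filter_upwards [hae] with ω hω
    rw [Real.norm_eq_abs, abs_of_nonneg (trunc_nonneg _ _)]
    exact trunc_le_one hR (not_lt.mp hω)
  · refine .of_forall fun ω => ?_
    have h1 : Tendsto (fun R : ℝ => 1 - ω / R) atTop (nhds (1 - 0)) :=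
      tendsto_const_nhds.sub (tendsto_const_nhds.div_atTop tendsto_id)
    have h2 := (h1.max (tendsto_const_nhds (x := (0 : ℝ)))).pow 3
    simpa [trunc] using h2

lemma tendsto_integral_trunc_zero {μ : Measure ℝ} [IsFiniteMeasure μ] (hμ : μ (Iio 0) = 0) :
    Tendsto (fun R : ℝ => ∫ ω, trunc R ω ∂μ) (nhdsWithin 0 (Ioi 0)) (nhds (μ.real {0})) := by
  have hae : ∀ᵐ ω ∂μ, ω ∉ Iio 0 := measure_eq_zero_iff_ae_notMem.mp hμ
  have : μ.real {0} = ∫ ω, ({0} : Set ℝ).indicator (fun _ => (1 : ℝ)) ω ∂μ := by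
    rw [integral_indicator_const _ (measurableSet_singleton 0), smul_eq_mul, mul_one]
  rw [this]
  refine tendsto_integral_filter_of_dominated_convergence (fun _ => 1)
    (.of_forall fun R => (contDiff_trunc R).continuous.aestronglyMeasurable) ?_
    (integrable_const _) ?_
  · filter_upwards [self_mem_nhdsWithin] with R hR
    filter_upwards [hae] with ω hω
    rw [Real.norm_eq_abs, abs_of_nonneg (trunc_nonneg _ _)]
    exact trunc_le_one hR (not_lt.mp hω)
  · filter_upwards [hae] with ω hω
    have h0 : 0 ≤ ω := not_lt.mp hω
    rcases h0.eq_or_lt with rfl | hpos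
    · simp [trunc]
    · rw [indicator_of_notMem (by simpa using hpos.ne')]
      refine tendsto_const_nhds.congr' ?_
      filter_upwards [Ioo_mem_nhdsGT hpos] with R hR
      exact (trunc_eq_zero hR.1 hR.2.le).symm

/-- Every `g t` is a finite measure of mass `m`. -/
def HasMass (m : ℝ) (g : ℝ → Measure ℝ) : Prop :=
  ∀ t, 0 ≤ t → IsFiniteMeasure (g t) ∧ (g t).real univ = m

section WeakSolution

variable {ρ m : ℝ} {gin : Measure ℝ} {g : ℝ → Measure ℝ}

lemma IsWeakSolution.isFiniteMeasure (hg : IsWeakSolution ρ 0 gin g) (hρ : ρ < -1)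
    (hgin : 0 < (gin univ).toReal) {t : ℝ} (ht : 0 ≤ t) : IsFiniteMeasure (g t) := by
  have hfin : IsFiniteMeasure gin := ⟨(ENNReal.toReal_pos_iff.mp hgin).2⟩
  have hgin0 : gin (Iio 0) = 0 := by
    have := (hg.1 0 le_rfl).1
    rwa [hg.2.2.1] at this
  obtain ⟨R, hRpos, hR⟩ := ((tendsto_integral_trunc_atTop hgin0).eventually
    (Ioi_mem_nhds hgin)).and (eventually_gt_atTop 0) |>.exists
  have hpos : 0 < ∫ ω, trunc R ω ∂(g t) :=
    lt_of_lt_of_le hRpos (hg.integral_trunc_init_le hρ hR ht)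
  have hint : Integrable (trunc R) (g t) := by
    by_contra hni
    rw [integral_undef hni] at hpos
    exact lt_irrefl _ hpos
  have h0 : g t {0} < ⊤ := by
    refine lt_of_le_of_lt (measure_mono ?_) (hint.measure_norm_ge_lt_top one_pos)
    rintro _ rfl
    simp [trunc]
  have h1 := (hg.1 t ht).isFiniteMeasure_restrict hρ
  have h2 : g t (Ioi 0) < ⊤ := by
    have := h1.measure_univ_lt_top
    rwa [Measure.restrict_apply_univ] at this
  constructor
  have hcov : (univ : Set ℝ) ⊆ Iio 0 ∪ ({0} ∪ Ioi 0) := fun x _ => by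
    rcases lt_trichotomy x 0 with h | h | h <;> simp [h]
  refine (measure_mono hcov).trans_lt ((measure_union_le _ _).trans_lt ?_)
  rw [(hg.1 t ht).1, zero_add]
  exact (measure_union_le _ _).trans_lt (ENNReal.add_lt_top.mpr ⟨h0, h2⟩)

lemma IsWeakSolution.hasMass (hg : IsWeakSolution ρ 0 gin g) (hρ : ρ < -1)
    (hgin : 0 < (gin univ).toReal) : HasMass (gin univ).toReal g := by
  intro t ht
  have hfin : ∀ s, 0 ≤ s → IsFiniteMeasure (g s) := fun s hs => hg.isFiniteMeasure hρ hgin hs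
  refine ⟨hfin t ht, ?_⟩
  have := hfin t ht
  have hlim : ∀ s, 0 ≤ s →
      Tendsto (fun R : ℝ => ∫ ω, trunc R ω ∂(g s)) atTop (nhds ((g s).real univ)) := by
    intro s hs
    have := hfin s hs
    exact tendsto_integral_trunc_atTop (hg.1 s hs).1
  have hmono : ∀ s ∈ Ioc 0 t, (g s).real univ ≤ (g t).real univ := by
    intro s hs
    refine le_of_tendsto_of_tendsto (hlim s hs.1.le) (hlim t ht) ?_
    filter_upwards [eventually_gt_atTop 0] with R hR
    exact hg.integral_trunc_mono hρ hR hs.1.le hs.2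
  have hbound : ∀ᶠ R : ℝ in atTop, |∫ ω, trunc R ω ∂(g t) - ∫ ω, trunc R ω ∂(g 0)| ≤
      2 * (3 / R) * (g t).real univ ^ 3 * t := by
    filter_upwards [eventually_gt_atTop 0] with R hR
    rw [hg.2.2.1, hg.weak_form_const (contDiff_trunc R) (fun ω => trunc_eq_zero hR) ht,
      ← Real.norm_eq_abs]
    refine (norm_setIntegral_le_of_norm_le_const (C := 2 * (3 / R) * (g t).real univ ^ 3)
      measure_Ioc_lt_top fun s hs => ?_).trans (le_of_eq ?_)
    · have := hfin s hs.1.le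
      refine (abs_collisionInt_le (isLipTest_trunc hR)).trans ?_
      gcongr
      exact hmono s hs
    · rw [Real.volume_real_Ioc_of_le ht, sub_zero]
  have hz : Tendsto (fun R : ℝ => 2 * (3 / R) * (g t).real univ ^ 3 * t) atTop (nhds 0) := by
    have h1 : Tendsto (fun R : ℝ => 3 / R) atTop (nhds 0) :=
      tendsto_const_nhds.div_atTop tendsto_id
    have h2 := ((h1.const_mul 2).mul_const ((g t).real univ ^ 3)).mul_const t
    simpa using h2
  have h3 := squeeze_zero_norm' (f := fun R : ℝ => ∫ ω, trunc R ω ∂(g t) -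
    ∫ ω, trunc R ω ∂(g 0)) (by simpa only [Real.norm_eq_abs] using hbound) hz
  have h4 := tendsto_nhds_unique h3 ((hlim t ht).sub (hlim 0 le_rfl))
  rw [hg.2.2.1] at h4
  change (g t).real univ = gin.real univ
  linarith

lemma IsWeakSolution.condensate_mono (hg : IsWeakSolution ρ 0 gin g) (hρ : ρ < -1)
    (hm : HasMass m g) {s t : ℝ} (hs : 0 ≤ s) (hst : s ≤ t) : g s {0} ≤ g t {0} := by
  have hs' := (hm s hs).1
  have ht' := (hm t (hs.trans hst)).1
  have : (g s).real {0} ≤ (g t).real {0} := by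
    refine le_of_tendsto_of_tendsto (tendsto_integral_trunc_zero (hg.1 s hs).1)
      (tendsto_integral_trunc_zero (hg.1 t (hs.trans hst)).1) ?_
    filter_upwards [self_mem_nhdsWithin] with R hR
    exact hg.integral_trunc_mono hρ hR hs hst
  exact (ENNReal.toReal_le_toReal (measure_ne_top _ _) (measure_ne_top _ _)).mp this

lemma IsWeakSolution.measurable_family (hg : IsWeakSolution ρ 0 gin g) (hm : HasMass m g) :
    Measurable fun t => g (max t 0) := by
  have hfin : ∀ t, IsFiniteMeasure (g (max t 0)) := fun t => (hm _ (le_max_right _ _)).1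
  refine Measurable.measure_of_isPiSystem
    (borel_eq_generateFrom_Iic ℝ ▸ BorelSpace.measurable_eq) isPiSystem_Iic ?_ ?_
  · rintro _ ⟨x, rfl⟩
    let φ : ℕ → ℝ → ℝ := fun n ω => max 0 (min 1 (1 - (n + 1) * (ω - x)))
    have hφ0 : ∀ n ω, x + 1 ≤ ω → φ n ω = 0 := by
      intro n ω h
      refine max_eq_left ((min_le_right _ _).trans ?_)
      have : (0 : ℝ) ≤ n := n.cast_nonneg
      nlinarith
    have hφc : ∀ n, Continuous (φ n) := fun n => by fun_prop
    have hmeas : ∀ n, Measurable fun t => ∫ ω, φ n ω ∂(g (max t 0)) := by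
      intro n
      have h1 := hg.continuousOn_integral (hφc n) (hφ0 n)
      exact (h1.comp_continuous (f := fun t : ℝ => max t 0) (by fun_prop)
        fun t => mem_Ici.mpr (le_max_right _ _)).measurable
    have hlim : Measurable fun t => (g (max t 0)).real (Iic x) := by
      refine measurable_of_tendsto_metrizable hmeas (tendsto_pi_nhds.mpr fun t => ?_)
      have : (g (max t 0)).real (Iic x)
          = ∫ ω, (Iic x).indicator (fun _ => (1 : ℝ)) ω ∂(g (max t 0)) := by
        rw [integral_indicator_const _ measurableSet_Iic, smul_eq_mul, mul_one]
      rw [this]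
      refine tendsto_integral_of_dominated_convergence (fun _ => 1)
        (fun n => (hφc n).aestronglyMeasurable) (integrable_const _) ?_ ?_
      · refine fun n => .of_forall fun ω => ?_
        rw [Real.norm_eq_abs, abs_of_nonneg (le_max_left _ _)]
        exact max_le zero_le_one (min_le_left _ _)
      · refine .of_forall fun ω => ?_
        by_cases hω : ω ≤ x
        · rw [indicator_of_mem (mem_Iic.mpr hω)]
          refine tendsto_const_nhds.congr fun n => ?_
          have : (0 : ℝ) ≤ n := n.cast_nonneg
          have h1 : (1 : ℝ) ≤ 1 - (n + 1) * (ω - x) := by nlinarith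
          change 1 = max 0 (min 1 (1 - ((n : ℝ) + 1) * (ω - x)))
          rw [min_eq_left h1, max_eq_right zero_le_one]
        · rw [indicator_of_notMem (by simpa using hω)]
          push Not at hω
          obtain ⟨N, hN⟩ := exists_nat_gt (1 / (ω - x))
          refine tendsto_const_nhds.congr' ?_
          filter_upwards [eventually_ge_atTop N] with n hn
          have hd : 0 < ω - x := by linarith
          have hn' : (N : ℝ) ≤ n := by exact_mod_cast hn
          rw [div_lt_iff₀ hd] at hN
          refine (max_eq_left ((min_le_right _ _).trans ?_)).symm
          nlinarith
    have : (fun t => g (max t 0) (Iic x))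
        = fun t => ENNReal.ofReal ((g (max t 0)).real (Iic x)) := by
      ext t
      rw [ofReal_measureReal]
    rw [this]
    exact hlim.ennreal_ofReal
  · have : (fun t => g (max t 0) univ) = fun _ => ENNReal.ofReal m := by
      ext t
      have := hfin t
      rw [← (hm _ (le_max_right t 0)).2, ofReal_measureReal]
    rw [this]
    exact measurable_const

lemma IsWeakSolution.measurable_collisionInt (hg : IsWeakSolution ρ 0 gin g) (hm : HasMass m g)
    {L : ℝ} {ψ : ℝ → ℝ} (hψ : IsLipTest L ψ) :
    Measurable fun t => collisionInt 0 (g (max t 0)) ψ := by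
  let κ : ProbabilityTheory.Kernel ℝ ℝ := ⟨fun t => g (max t 0), hg.measurable_family hm⟩
  have hκ : ∀ t, κ t = g (max t 0) := fun _ => rfl
  have : ProbabilityTheory.IsFiniteKernel κ := by
    refine ⟨ENNReal.ofReal m, ENNReal.ofReal_lt_top, fun t => ?_⟩
    have := (hm _ (le_max_right t 0)).1
    rw [← (hm _ (le_max_right t 0)).2, ofReal_measureReal, hκ]
  have h := (measurable_collTerm hψ.meas).stronglyMeasurable.integral_kernel
    (κ := κ.prod (κ.prod κ))
  have e : (fun t => collisionInt 0 (g (max t 0)) ψ)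
      = fun t => ∫ p, collTerm ψ p.1 p.2.1 p.2.2 ∂(κ.prod (κ.prod κ) t) := by
    ext t
    have := (hm _ (le_max_right t 0)).1
    rw [collisionInt_eq_integral_prod hψ, ProbabilityTheory.Kernel.prod_apply,
      ProbabilityTheory.Kernel.prod_apply, hκ]
  rw [e]
  exact h.measurable

lemma IsWeakSolution.integrableOn_collisionInt (hg : IsWeakSolution ρ 0 gin g)
    (hm : HasMass m g) {L : ℝ} {ψ : ℝ → ℝ} (hψ : IsLipTest L ψ) (T : ℝ) :
    IntegrableOn (fun t => collisionInt 0 (g t) ψ) (Ioc 0 T) := by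
  have h1 : IntegrableOn (fun t => collisionInt 0 (g (max t 0)) ψ) (Ioc 0 T) := by
    refine Measure.integrableOn_of_bounded (M := 2 * L * m ^ 3) measure_Ioc_lt_top.ne
      (hg.measurable_collisionInt hm hψ).aestronglyMeasurable (.of_forall fun t => ?_)
    obtain ⟨h1, h2⟩ := hm _ (le_max_right t 0)
    rw [← h2]
    exact abs_collisionInt_le hψ
  exact h1.congr_fun (fun t ht => by simp only [max_eq_left ht.1.le]) measurableSet_Ioc

end WeakSolution

lemma sq_mul_measureReal_le_collisionInt_trunc {μ : Measure ℝ} [IsFiniteMeasure μ] {r ε q : ℝ}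
    (hr : 0 < r) (hε : 0 < ε) (hε1 : ε ≤ 1) :
    ε ^ 2 * μ.real (Ioc 0 q) * μ.real (Ioc (r / 16) r ∩ Ioi ((1 + ε) * q)) ^ 2 ≤
      12288 * r * collisionInt 0 μ (trunc (4 * r)) := by
  have h := le_collisionInt_trunc (μ := μ) (r := r) (β := ε / 32)
    (J := Ioc (r / 16) r ∩ Ioi ((1 + ε) * q)) (K := Ioc 0 q) hr (by positivity)
    (measurableSet_Ioc.inter measurableSet_Ioi) measurableSet_Ioc (fun y hy => hy.1.2)
    (fun z hz => hz.1) ?_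
  · linarith
  · rintro y ⟨⟨hy1, -⟩, hy2⟩ z ⟨hz0, hz⟩
    have h1 : (1 + ε) * z < y := lt_of_le_of_lt (by gcongr) hy2
    have h2 : ε * (r / 16) ≤ ε * y := by gcongr
    have h3 : 0 < y - z := by nlinarith
    nlinarith [mul_nonneg (sub_nonneg.mpr hε1) h3.le]

/-- The dissipation at the dyadic-type scales `L / 16 ^ j`, weighted by `4 ^ (-j)`. -/
def fluxSum (L : ℝ) (μ : Measure ℝ) : ENNReal :=
  ∑' j : ℕ, ENNReal.ofReal ((1 / 4) ^ j * collisionInt 0 μ (trunc (4 * (L / 16 ^ j))))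

lemma measureReal_Ioc_inter_le_sum {μ : Measure ℝ} [IsFiniteMeasure μ] (L : ℝ) (B : Set ℝ)
    (N : ℕ) : μ.real (Ioc (L / 16 ^ N) L ∩ B) ≤
      ∑ j ∈ Finset.range N, μ.real (Ioc (L / 16 ^ j / 16) (L / 16 ^ j) ∩ B) := by
  induction N with
  | zero => simp
  | succ N ih =>
    rw [Finset.sum_range_succ]
    refine le_trans ?_ (add_le_add ih le_rfl)
    refine (measureReal_mono ?_).trans (measureReal_union_le _ _)
    rintro x ⟨⟨h1, h2⟩, h3⟩
    rcases lt_or_ge (L / 16 ^ N) x with h | h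
    · exact Or.inl ⟨⟨h, h2⟩, h3⟩
    · exact Or.inr ⟨⟨by rwa [div_div, ← pow_succ], h⟩, h3⟩

/-- Small dissipation forces the mass above `(1 + ε) q` or the mass below `q` to be small. -/
lemma concentration_of_fluxSum_le {μ : Measure ℝ} [IsFiniteMeasure μ] {ε q L s : ℝ}
    (hε : 0 < ε) (hε1 : ε ≤ 1) (hq : 0 < q) (hL : 0 < L) (hs : 0 ≤ s)
    (hS : fluxSum L μ ≤ ENNReal.ofReal s) :
    ε ^ 2 * μ.real (Ioc 0 q) * μ.real (Ioc ((1 + ε) * q) L) ^ 2 ≤ 49152 * L * s := by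
  set a := ε ^ 2 * μ.real (Ioc 0 q) with ha
  have ha0 : 0 ≤ a := by positivity
  set c := 12288 * L * s with hc
  have hc0 : 0 ≤ c := by positivity
  have hscale : ∀ j : ℕ, √a * μ.real (Ioc (L / 16 ^ j / 16) (L / 16 ^ j) ∩ Ioi ((1 + ε) * q)) ≤
      √c * (1 / 2) ^ j := by
    intro j
    have h1 := sq_mul_measureReal_le_collisionInt_trunc (μ := μ) (q := q)
      (show 0 < L / 16 ^ j by positivity) hε hε1
    have h2 : (1 / 4) ^ j * collisionInt 0 μ (trunc (4 * (L / 16 ^ j))) ≤ s :=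
      (ENNReal.ofReal_le_ofReal_iff hs).mp ((ENNReal.le_tsum j).trans hS)
    refine abs_le_of_sq_le_sq' ?_ (by positivity) |>.2
    rw [mul_pow, mul_pow, sq_sqrt ha0, sq_sqrt hc0]
    refine h1.trans ?_
    have e : (12288 : ℝ) * (L / 16 ^ j) * collisionInt 0 μ (trunc (4 * (L / 16 ^ j)))
        = 12288 * L * (1 / 4) ^ j *
          ((1 / 4) ^ j * collisionInt 0 μ (trunc (4 * (L / 16 ^ j)))) := by
      rw [div_eq_mul_one_div L, ← one_div_pow,
        show (1 / 16 : ℝ) ^ j = (1 / 4) ^ j * (1 / 4) ^ j by rw [← mul_pow]; norm_num]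
      ring
    have e2 : ((1 / 2 : ℝ) ^ j) ^ 2 = (1 / 4) ^ j := by
      rw [← pow_mul, mul_comm j 2, pow_mul]
      norm_num
    rw [e, e2, hc, show 12288 * L * s * (1 / 4) ^ j = 12288 * L * (1 / 4) ^ j * s by ring]
    gcongr
  have hlim : Tendsto (fun N : ℕ => L / (16 : ℝ) ^ N) atTop (nhds 0) :=
    tendsto_const_nhds.div_atTop (tendsto_pow_atTop_atTop_of_one_lt (by norm_num))
  obtain ⟨N, hN⟩ := (hlim.eventually (Iio_mem_nhds (show 0 < (1 + ε) * q by positivity))).exists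
  have hsum : √a * μ.real (Ioc ((1 + ε) * q) L) ≤ 2 * √c := by
    have h1 : μ.real (Ioc ((1 + ε) * q) L) ≤
        μ.real (Ioc (L / 16 ^ N) L ∩ Ioi ((1 + ε) * q)) :=
      measureReal_mono fun x hx => ⟨⟨lt_trans hN hx.1, hx.2⟩, hx.1⟩
    calc √a * μ.real (Ioc ((1 + ε) * q) L)
        ≤ √a * ∑ j ∈ Finset.range N,
          μ.real (Ioc (L / 16 ^ j / 16) (L / 16 ^ j) ∩ Ioi ((1 + ε) * q)) := by
          gcongr
          exact h1.trans (measureReal_Ioc_inter_le_sum L _ N)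
      _ ≤ ∑ j ∈ Finset.range N, √c * (1 / 2) ^ j := by
          rw [Finset.mul_sum]
          exact Finset.sum_le_sum fun j _ => hscale j
      _ ≤ 2 * √c := by
          rw [← Finset.mul_sum, mul_comm]
          gcongr
          exact (summable_geometric_two.sum_le_tsum _ fun j _ => by positivity).trans_eq
            tsum_geometric_two
  have h2 : (√a * μ.real (Ioc ((1 + ε) * q) L)) ^ 2 ≤ (2 * √c) ^ 2 := by gcongr
  rw [mul_pow, mul_pow, sq_sqrt ha0, sq_sqrt hc0] at h2
  linarith

section WeakSolution

variable {ρ m : ℝ} {gin : Measure ℝ} {g : ℝ → Measure ℝ}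

lemma HasMass.integral_trunc_le (hm : HasMass m g) {R t : ℝ} (hR : 0 < R) (ht : 0 ≤ t)
    (h0 : g t (Iio 0) = 0) : ∫ ω, trunc R ω ∂(g t) ≤ m := by
  obtain ⟨h1, h2⟩ := hm t ht
  have : ∫ ω, trunc R ω ∂(g t) ≤ ∫ _, (1 : ℝ) ∂(g t) := by
    refine integral_mono_of_nonneg (.of_forall fun _ => trunc_nonneg _ _)
      (integrable_const _) ?_
    filter_upwards [measure_eq_zero_iff_ae_notMem.mp h0] with ω hω
    exact trunc_le_one hR (not_lt.mp hω)
  simpa [h2] using this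

lemma IsWeakSolution.measurable_fluxSum (hg : IsWeakSolution ρ 0 gin g) (hm : HasMass m g)
    {L : ℝ} (hL : 0 < L) : Measurable fun t => fluxSum L (g (max t 0)) :=
  Measurable.tsum fun j => ((hg.measurable_collisionInt hm
    (isLipTest_trunc (show 0 < 4 * (L / 16 ^ j) by positivity))).const_mul _).ennreal_ofReal

lemma IsWeakSolution.lintegral_fluxSum_le (hg : IsWeakSolution ρ 0 gin g) (hρ : ρ < -1)
    (hm : HasMass m g) {L T : ℝ} (hL : 0 < L) (hT : 0 ≤ T) :
    ∫⁻ t in Ioc 0 T, fluxSum L (g (max t 0)) ≤ ENNReal.ofReal (2 * m) := by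
  have hm0 : 0 ≤ m := (hm 0 le_rfl).2 ▸ measureReal_nonneg
  have hterm : ∀ j : ℕ, ∫⁻ t in Ioc 0 T, ENNReal.ofReal ((1 / 4) ^ j *
      collisionInt 0 (g (max t 0)) (trunc (4 * (L / 16 ^ j)))) ≤
      ENNReal.ofReal ((1 / 2) ^ j * m) := by
    intro j
    have hR : 0 < 4 * (L / 16 ^ j) := by positivity
    have e : ∫⁻ t in Ioc 0 T, ENNReal.ofReal ((1 / 4) ^ j *
        collisionInt 0 (g (max t 0)) (trunc (4 * (L / 16 ^ j)))) =
        ∫⁻ t in Ioc 0 T, ENNReal.ofReal ((1 / 4) ^ j *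
        collisionInt 0 (g t) (trunc (4 * (L / 16 ^ j)))) :=
      setLIntegral_congr_fun measurableSet_Ioc fun t ht => by
        simp only [max_eq_left ht.1.le]
    rw [e, ← ofReal_integral_eq_lintegral_ofReal
      ((hg.integrableOn_collisionInt hm (isLipTest_trunc hR) T).const_mul _)
      ((ae_restrict_iff' measurableSet_Ioc).mpr (.of_forall fun t ht => mul_nonneg (by positivity)
        (hg.collisionInt_nonneg hρ (isLipTest_trunc hR) (convexOn_trunc _) ht.1.le)))]
    refine ENNReal.ofReal_le_ofReal ?_
    rw [integral_const_mul,
      ← hg.weak_form_const (contDiff_trunc _) (fun ω => trunc_eq_zero hR) hT]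
    have h1 := hm.integral_trunc_le hR hT (hg.1 T hT).1
    have h2 : 0 ≤ ∫ ω, trunc (4 * (L / 16 ^ j)) ω ∂gin :=
      integral_nonneg fun _ => trunc_nonneg _ _
    have h3 : (1 / 4 : ℝ) ^ j ≤ (1 / 2) ^ j := by gcongr; norm_num
    calc (1 / 4 : ℝ) ^ j * _ ≤ (1 / 4) ^ j * m := by gcongr; linarith
      _ ≤ _ := by gcongr
  unfold fluxSum
  rw [lintegral_tsum fun j => ((hg.measurable_collisionInt hm
    (isLipTest_trunc (show 0 < 4 * (L / 16 ^ j) by positivity))).const_mul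
      _).ennreal_ofReal.aemeasurable]
  refine (ENNReal.tsum_le_tsum hterm).trans (le_of_eq ?_)
  rw [← ENNReal.ofReal_tsum_of_nonneg (fun j => by positivity)
    (summable_geometric_two.mul_right m), tsum_mul_right, tsum_geometric_two]

/-- The times at which the dissipation below scale `L` is small. -/
def goodTimes (g : ℝ → Measure ℝ) (L : ℝ) : Set ℝ :=
  {t | 1 < t ∧ fluxSum L (g (max t 0)) ≤ ENNReal.ofReal ((√t)⁻¹)}

lemma IsWeakSolution.le_volume_goodTimes (hg : IsWeakSolution ρ 0 gin g) (hρ : ρ < -1)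
    (hm : HasMass m g) {L T : ℝ} (hL : 0 < L) (hT : 0 < T) :
    T - 1 - 2 * m * √T ≤ volume.real (goodTimes g L ∩ Icc 0 T) := by
  have hm0 : 0 ≤ m := (hm 0 le_rfl).2 ▸ measureReal_nonneg
  set B := {t | ENNReal.ofReal ((√T)⁻¹) ≤ fluxSum L (g (max t 0))} ∩ Ioc 0 T with hB
  have hBm : volume B ≤ ENNReal.ofReal (2 * m * √T) := by
    have h1 := mul_meas_ge_le_lintegral (μ := volume.restrict (Ioc 0 T))
      (hg.measurable_fluxSum hm hL) (ENNReal.ofReal ((√T)⁻¹))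
    rw [Measure.restrict_apply' measurableSet_Ioc] at h1
    have h2 := h1.trans (hg.lintegral_fluxSum_le hρ hm hL hT.le)
    have h3 : ENNReal.ofReal (√T) * (ENNReal.ofReal ((√T)⁻¹) * volume B) ≤
        ENNReal.ofReal (√T) * ENNReal.ofReal (2 * m) := by gcongr
    rwa [← mul_assoc, ← ENNReal.ofReal_mul (by positivity), mul_inv_cancel₀ (by positivity),
      ENNReal.ofReal_one, one_mul, ← ENNReal.ofReal_mul (by positivity), mul_comm (√T)] at h3
  have hcov : Icc 0 T ⊆ (goodTimes g L ∩ Icc 0 T) ∪ (Icc 0 1 ∪ B) := by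
    intro t ht
    rcases le_or_gt t 1 with h | h
    · exact Or.inr (Or.inl ⟨ht.1, h⟩)
    · by_cases hS : fluxSum L (g (max t 0)) ≤ ENNReal.ofReal ((√t)⁻¹)
      · exact Or.inl ⟨⟨h, hS⟩, ht⟩
      · refine Or.inr (Or.inr ⟨?_, by linarith, ht.2⟩)
        have h0 : 0 < t := by linarith
        have : ENNReal.ofReal ((√T)⁻¹) ≤ ENNReal.ofReal ((√t)⁻¹) := by
          have := ht.2
          have : 0 < √t := by positivity
          gcongr
        exact this.trans (not_le.mp hS).le
  have hfin : volume (goodTimes g L ∩ Icc 0 T) ≠ ⊤ :=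
    measure_ne_top_of_subset inter_subset_right measure_Icc_lt_top.ne
  have hBfin : volume B ≠ ⊤ := ne_top_of_le_ne_top ENNReal.ofReal_ne_top hBm
  have h1 : volume.real (Icc 0 T) ≤
      volume.real (goodTimes g L ∩ Icc 0 T) + (volume.real (Icc (0 : ℝ) 1) + volume.real B) := by
    refine (measureReal_mono hcov ?_).trans ((measureReal_union_le _ _).trans
      (add_le_add le_rfl (measureReal_union_le _ _)))
    exact measure_union_ne_top hfin (measure_union_ne_top measure_Icc_lt_top.ne hBfin)
  have h2 : volume.real B ≤ 2 * m * √T := ENNReal.toReal_le_of_le_ofReal (by positivity) hBm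
  rw [Real.volume_real_Icc_of_le hT.le, Real.volume_real_Icc_of_le zero_le_one] at h1
  linarith

lemma IsWeakSolution.tendsto_density_goodTimes (hg : IsWeakSolution ρ 0 gin g) (hρ : ρ < -1)
    (hm : HasMass m g) {L : ℝ} (hL : 0 < L) :
    Tendsto (fun T : ℝ => (volume (goodTimes g L ∩ Icc 0 T)).toReal / T) atTop (nhds 1) := by
  have hlow : Tendsto (fun T : ℝ => 1 - 1 / T - 2 * m / √T) atTop (nhds (1 - 0 - 0)) :=
    (tendsto_const_nhds.sub (tendsto_const_nhds.div_atTop tendsto_id)).sub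
      (tendsto_const_nhds.div_atTop tendsto_sqrt_atTop)
  rw [sub_zero, sub_zero] at hlow
  refine tendsto_of_tendsto_of_tendsto_of_le_of_le' hlow tendsto_const_nhds ?_ ?_
  · filter_upwards [eventually_gt_atTop 0] with T hT
    rw [le_div_iff₀ hT]
    refine le_trans (le_of_eq ?_) (hg.le_volume_goodTimes hρ hm hL hT)
    have h1 : √T * √T = T := mul_self_sqrt hT.le
    have h2 : 0 < √T := by positivity
    field_simp
    linear_combination 2 * m * h1
  · filter_upwards [eventually_gt_atTop 0] with T hT
    rw [div_le_one hT]
    have : volume.real (goodTimes g L ∩ Icc 0 T) ≤ volume.real (Icc 0 T) :=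
      measureReal_mono inter_subset_right measure_Icc_lt_top.ne
    rwa [Real.volume_real_Icc_of_le hT.le, sub_zero] at this

lemma IsWeakSolution.exists_goodTimes_gt (hg : IsWeakSolution ρ 0 gin g) (hρ : ρ < -1)
    (hm : HasMass m g) {L : ℝ} (hL : 0 < L) (M : ℝ) : ∃ t ∈ goodTimes g L, M < t := by
  by_contra! hcon
  have hup : Tendsto (fun T : ℝ => max M 0 / T) atTop (nhds 0) :=
    tendsto_const_nhds.div_atTop tendsto_id
  have hle : (1 : ℝ) ≤ 0 := by
    refine le_of_tendsto_of_tendsto (hg.tendsto_density_goodTimes hρ hm hL) hup ?_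
    filter_upwards [eventually_gt_atTop 0] with T hT
    gcongr
    have : volume.real (goodTimes g L ∩ Icc 0 T) ≤ volume.real (Icc 0 (max M 0)) :=
      measureReal_mono (fun t ht => ⟨ht.2.1, (hcon t ht.1).trans (le_max_left _ _)⟩)
        measure_Icc_lt_top.ne
    rwa [Real.volume_real_Icc_of_le (le_max_right _ _), sub_zero] at this
  exact absurd hle (by norm_num)

end WeakSolution

lemma exists_bump (c : ℝ) {r : ℝ} (hr : 0 < r) : ∃ φ : ℝ → ℝ, ContDiff ℝ 2 φ ∧
    (∃ L, IsLipTest L φ) ∧ HasCompactSupport φ ∧ (∀ ω, 0 ≤ φ ω) ∧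
    ∀ ω, φ ω ≠ 0 ↔ ω ∈ Metric.ball c r := by
  let b : ContDiffBump c := ⟨r / 2, r, by positivity, by linarith⟩
  have hb : ContDiff ℝ 2 b := b.contDiff
  obtain ⟨C, hC⟩ := hb.lipschitzWith_of_hasCompactSupport b.hasCompactSupport (by norm_num)
  refine ⟨b, hb, ⟨C, C.2, hb.continuous.measurable, fun u v _ _ => ?_⟩,
    b.hasCompactSupport, fun _ => b.nonneg, fun ω => ?_⟩
  · simpa [Real.dist_eq] using hC.dist_le_mul u v
  · rw [← Function.mem_support, b.support_eq]

lemma msupport_subset_Ici {μ : Measure ℝ} {R : ℝ} (h : μ (Iio R) = 0) :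
    msupport μ ⊆ Ici R := by
  intro x hx
  by_contra hxR
  have hxR : x < R := not_le.mp hxR
  refine (hx (R - x) (sub_pos.mpr hxR)).ne' (measure_mono_null (fun y hy => ?_) h)
  rw [Metric.mem_ball, Real.dist_eq] at hy
  have := (abs_lt.mp hy).2
  exact mem_Iio.mpr (by linarith)

lemma msupport_nonempty {μ : Measure ℝ} (h : μ univ ≠ 0) : (msupport μ).Nonempty := by
  by_contra hne
  refine h (measure_null_of_locally_null _ fun x _ => ?_)
  have hx : x ∉ msupport μ := fun hx => hne ⟨x, hx⟩
  simp only [msupport, mem_ofPred_eq, not_forall, not_lt, nonpos_iff_eq_zero] at hx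
  obtain ⟨r, hr, h0⟩ := hx
  exact ⟨_, mem_nhdsWithin_of_mem_nhds (Metric.ball_mem_nhds x hr), h0⟩

lemma ae_ge_prod {μ : Measure ℝ} [SFinite μ] {R : ℝ} (hμ : μ (Iio R) = 0) :
    ∀ᵐ p ∂(μ.prod (μ.prod μ)), R ≤ p.1 ∧ R ≤ p.2.1 ∧ R ≤ p.2.2 := by
  have h0 : ∀ᵐ x ∂μ, R ≤ x := by
    filter_upwards [measure_eq_zero_iff_ae_notMem.mp hμ] with x hx using not_lt.mp hx
  have h1 := Measure.quasiMeasurePreserving_fst (μ := μ) (ν := μ.prod μ) |>.ae h0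
  have h2 := Measure.quasiMeasurePreserving_snd (μ := μ) (ν := μ.prod μ) |>.ae
    (Measure.quasiMeasurePreserving_fst (μ := μ) (ν := μ) |>.ae h0)
  have h3 := Measure.quasiMeasurePreserving_snd (μ := μ) (ν := μ.prod μ) |>.ae
    (Measure.quasiMeasurePreserving_snd (μ := μ) (ν := μ) |>.ae h0)
  filter_upwards [h1, h2, h3] with p a b c using ⟨a, b, c⟩

section AwayFromZero

variable {μ : Measure ℝ} [IsFiniteMeasure μ] {R L : ℝ} {φ : ℝ → ℝ}

lemma mul_le_loss_add_collTerm (hR : 0 < R) (hφ : ∀ ω, 0 ≤ φ ω) {x y z : ℝ} (hx : R ≤ x)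
    (hy : R ≤ y) (hz : R ≤ z) :
    collWeight x y z * φ (x + y - z) ≤ collTerm φ x y z + 1 / R * (φ x + φ y) := by
  have hw : collWeight x y z ≤ 1 / R := by
    refine (collWeight_le_left (hR.trans_le hx) (hR.trans_le hy) (hR.trans_le hz)).trans ?_
    gcongr
    rw [le_sqrt hR.le (by nlinarith)]
    nlinarith
  have h0 := collWeight_nonneg x y z
  have h1 := mul_nonneg h0 (hφ z)
  have h2 := mul_le_mul_of_nonneg_right hw (add_nonneg (hφ x) (hφ y))
  unfold collTerm
  linarith

lemma integral_loss_add_collTerm (hφL : IsLipTest L φ) (hφi : Integrable φ μ) :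
    Integrable (fun p : ℝ × ℝ × ℝ => collTerm φ p.1 p.2.1 p.2.2 + 1 / R * (φ p.1 + φ p.2.1))
      (μ.prod (μ.prod μ)) ∧
    ∫ p, (collTerm φ p.1 p.2.1 p.2.2 + 1 / R * (φ p.1 + φ p.2.1)) ∂(μ.prod (μ.prod μ)) =
      collisionInt 0 μ φ + 2 / R * μ.real univ ^ 2 * ∫ ω, φ ω ∂μ := by
  have i1 : Integrable (fun p : ℝ × ℝ × ℝ => φ p.1) (μ.prod (μ.prod μ)) := hφi.comp_fst _
  have i2 : Integrable (fun p : ℝ × ℝ × ℝ => φ p.2.1) (μ.prod (μ.prod μ)) :=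
    (hφi.comp_fst μ).comp_snd μ
  have e1 : ∫ p, φ p.1 ∂(μ.prod (μ.prod μ)) = μ.real univ ^ 2 * ∫ ω, φ ω ∂μ := by
    rw [integral_fun_fst, ← univ_prod_univ, measureReal_prod_prod, sq, smul_eq_mul]
  have e2 : ∫ p, φ p.2.1 ∂(μ.prod (μ.prod μ)) = μ.real univ ^ 2 * ∫ ω, φ ω ∂μ := by
    rw [integral_fun_snd (μ := μ) (ν := μ.prod μ) (fun q : ℝ × ℝ => φ q.1), integral_fun_fst, sq,
      smul_eq_mul, smul_eq_mul, mul_assoc]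
  have i3 : Integrable (fun p : ℝ × ℝ × ℝ => 1 / R * (φ p.1 + φ p.2.1)) (μ.prod (μ.prod μ)) :=
    (i1.add i2).const_mul _
  refine ⟨hφL.integrable.add i3, ?_⟩
  rw [integral_add hφL.integrable i3, integral_const_mul,
    integral_add i1 i2, e1, e2, collisionInt_eq_integral_prod hφL]
  ring

lemma neg_le_collisionInt (hR : 0 < R) (hμ : μ (Iio R) = 0) (hφL : IsLipTest L φ)
    (hφi : Integrable φ μ) (hφ : ∀ ω, 0 ≤ φ ω) :
    0 ≤ collisionInt 0 μ φ + 2 / R * μ.real univ ^ 2 * ∫ ω, φ ω ∂μ := by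
  rw [← (integral_loss_add_collTerm hφL hφi).2]
  refine integral_nonneg_of_ae ?_
  filter_upwards [ae_ge_prod hμ] with p hp
  exact (mul_nonneg (collWeight_nonneg _ _ _) (hφ _)).trans
    (mul_le_loss_add_collTerm hR hφ hp.1 hp.2.1 hp.2.2)

lemma neg_lt_collisionInt (hR : 0 < R) (hμ : μ (Iio R) = 0) (hφL : IsLipTest L φ)
    (hφc : Continuous φ) (hφi : Integrable φ μ) (hφ : ∀ ω, 0 ≤ φ ω) {x y z : ℝ}
    (hx : x ∈ msupport μ) (hy : y ∈ msupport μ) (hz : z ∈ msupport μ) (hw : 0 < x + y - z)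
    (hφw : φ (x + y - z) ≠ 0) :
    0 < collisionInt 0 μ φ + 2 / R * μ.real univ ^ 2 * ∫ ω, φ ω ∂μ := by
  obtain ⟨hi, he⟩ := integral_loss_add_collTerm (R := R) hφL hφi
  have hle := fun p : ℝ × ℝ × ℝ => fun hp : R ≤ p.1 ∧ R ≤ p.2.1 ∧ R ≤ p.2.2 =>
    mul_le_loss_add_collTerm hR hφ hp.1 hp.2.1 hp.2.2
  rw [← he, integral_pos_iff_support_of_nonneg_ae ?_ hi]
  · let O : Set (ℝ × ℝ × ℝ) :=
      {p | 0 < p.1 + p.2.1 - p.2.2} ∩ {p | φ (p.1 + p.2.1 - p.2.2) ≠ 0}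
    have hO : IsOpen O := (isOpen_lt continuous_const (by fun_prop)).inter
      (isOpen_ne_fun (by fun_prop) continuous_const)
    obtain ⟨r, hr, hball⟩ := Metric.isOpen_iff.mp hO (x, y, z) ⟨hw, hφw⟩
    have hpos : 0 < (μ.prod (μ.prod μ)) (Metric.ball (x, y, z) r) := by
      rw [← ball_prod_same, ← ball_prod_same, Measure.prod_prod, Measure.prod_prod]
      exact ENNReal.mul_pos (hx r hr).ne' (mul_ne_zero (hy r hr).ne' (hz r hr).ne')
    refine hpos.trans_le (measure_mono_ae ?_)
    filter_upwards [ae_ge_prod hμ] with p hp hpb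
    obtain ⟨h1, h2⟩ := hball hpb
    refine ne_of_gt (lt_of_lt_of_le (mul_pos (collWeight_pos (hR.trans_le hp.1)
      (hR.trans_le hp.2.1) (hR.trans_le hp.2.2) h1) ((hφ _).lt_of_ne' h2)) (hle p hp))
  · filter_upwards [ae_ge_prod hμ] with p hp
    exact (mul_nonneg (collWeight_nonneg _ _ _) (hφ _)).trans (hle p hp)

end AwayFromZero

/-- Backward Grönwall inequality in integral form. -/
lemma eq_zero_of_le_mul_integral {F : ℝ → ℝ} {Λ t : ℝ} (hF : ContinuousOn F (Ici 0))
    (hF0 : ∀ s, 0 ≤ s → 0 ≤ F s)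
    (h : ∀ s ∈ Icc 0 t, F s ≤ Λ * ∫ τ in s..t, F τ) : ∀ s ∈ Icc 0 t, F s = 0 := by
  set G : ℝ → ℝ := fun τ => F (max (t - τ) 0) with hG
  have hGc : Continuous G := hF.comp_continuous (f := fun τ => max (t - τ) 0) (by fun_prop)
    fun τ => mem_Ici.mpr (le_max_right _ _)
  set u : ℝ → ℝ := fun s => ∫ τ in (0 : ℝ)..s, G τ with hu
  have hu' : ∀ s, HasDerivAt u (G s) s := fun s =>
    (hGc.integral_hasStrictDerivAt 0 s).hasDerivAt
  have hue : ∀ s ∈ Icc 0 t, u s = ∫ τ in (t - s)..t, F τ := by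
    intro s hs
    have h1 := intervalIntegral.integral_comp_sub_left (a := 0) (b := s) F t
    rw [sub_zero] at h1
    rw [← h1]
    refine intervalIntegral.integral_congr fun τ hτ => ?_
    rw [uIcc_of_le hs.1] at hτ
    simp only [hG, max_eq_left (show 0 ≤ t - τ by linarith [hτ.2, hs.2])]
  have hu0 : ∀ s, 0 ≤ s → 0 ≤ u s := fun s hs =>
    intervalIntegral.integral_nonneg hs fun τ _ => hF0 _ (le_max_right _ _)
  have hGu : ∀ s ∈ Icc 0 t, G s ≤ Λ * u s := by
    intro s hs
    have h1 := h (t - s) ⟨by linarith [hs.2], by linarith [hs.1]⟩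
    rw [← hue s hs] at h1
    simpa only [hG, max_eq_left (show 0 ≤ t - s by linarith [hs.2])] using h1
  have hzero := eq_zero_of_abs_deriv_le_mul_abs_self_of_eq_zero_right (f := u) (f' := G)
    (K := Λ) (a := 0) (b := t) (fun s _ => (hu' s).continuousAt.continuousWithinAt)
    (fun s _ => (hu' s).hasDerivWithinAt) (by simp [hu]) fun s hs => by
      rw [Real.norm_eq_abs, Real.norm_eq_abs, abs_of_nonneg (hF0 _ (le_max_right _ _)),
        abs_of_nonneg (hu0 s hs.1)]
      exact hGu s ⟨hs.1, hs.2.le⟩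
  intro s hs
  have hs' : t - s ∈ Icc 0 t := ⟨by linarith [hs.2], by linarith [hs.1]⟩
  have h1 := hGu _ hs'
  rw [hzero _ hs', mul_zero] at h1
  have h2 : G (t - s) = F s := by simp [hG, max_eq_left hs.1]
  exact le_antisymm (h2 ▸ h1) (hF0 s hs.1)

section WeakSolution

variable {ρ m : ℝ} {gin : Measure ℝ} {g : ℝ → Measure ℝ}

lemma IsWeakSolution.integral_sub_integral (hg : IsWeakSolution ρ 0 gin g) (hm : HasMass m g)
    {φ : ℝ → ℝ} (hφ2 : ContDiff ℝ 2 φ) {L R : ℝ} (hφL : IsLipTest L φ)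
    (hR : ∀ ω, R ≤ ω → φ ω = 0) {s t : ℝ} (hs : 0 ≤ s) (hst : s ≤ t) :
    ∫ ω, φ ω ∂(g t) - ∫ ω, φ ω ∂(g s) = ∫ τ in s..t, collisionInt 0 (g τ) φ := by
  have hi : ∀ T, 0 ≤ T → IntervalIntegrable (fun τ => collisionInt 0 (g τ) φ) volume 0 T :=
    fun T hT => (intervalIntegrable_iff_integrableOn_Ioc_of_le hT).mpr
      (hg.integrableOn_collisionInt hm hφL T)
  rw [← intervalIntegral.integral_interval_sub_left (hi t (hs.trans hst)) (hi s hs),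
    intervalIntegral.integral_of_le hs, intervalIntegral.integral_of_le (hs.trans hst),
    ← hg.weak_form_const hφ2 hR hs, ← hg.weak_form_const hφ2 hR (hs.trans hst)]
  ring

variable {r : ℝ}

/-- If no mass ever enters `[0, r)`, a test integral vanishing at time `t` vanished before. -/
lemma IsWeakSolution.integral_eq_zero_of_le (hg : IsWeakSolution ρ 0 gin g) (hm : HasMass m g)
    (hr : 0 < r) (hsupp : ∀ t, 0 ≤ t → g t (Iio r) = 0) {φ : ℝ → ℝ} (hφ2 : ContDiff ℝ 2 φ)
    {L R : ℝ} (hφL : IsLipTest L φ) (hφc : HasCompactSupport φ)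
    (hR : ∀ ω, R ≤ ω → φ ω = 0) (hφ : ∀ ω, 0 ≤ φ ω)
    {t : ℝ} (h0 : ∫ ω, φ ω ∂(g t) = 0) : ∀ s ∈ Icc 0 t, ∫ ω, φ ω ∂(g s) = 0 := by
  have hcont := hg.continuousOn_integral hφ2.continuous hR
  refine eq_zero_of_le_mul_integral (F := fun s => ∫ ω, φ ω ∂(g s)) (Λ := 2 / r * m ^ 2) hcont
    (fun s _ => integral_nonneg hφ) fun s hs => ?_
  have h1 := hg.integral_sub_integral hm hφ2 hφL hR hs.1 hs.2
  rw [h0, zero_sub] at h1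
  rw [← neg_eq_iff_eq_neg.mpr h1.symm, ← intervalIntegral.integral_neg,
    ← intervalIntegral.integral_const_mul]
  have hts := hs.1.trans hs.2
  refine intervalIntegral.integral_mono_on hs.2 ?_ ?_ fun τ hτ => ?_
  · exact ((intervalIntegrable_iff_integrableOn_Ioc_of_le hs.2).mpr
      ((hg.integrableOn_collisionInt hm hφL t).mono_set (Ioc_subset_Ioc_left hs.1))).neg
  · exact ((hcont.mono fun τ hτ => mem_Ici.mpr (hs.1.trans
      ((uIcc_of_le hs.2 ▸ hτ : τ ∈ Icc s t).1))).intervalIntegrable).const_mul _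
  · have hτ0 := hs.1.trans hτ.1
    obtain ⟨hfin, hmass⟩ := hm τ hτ0
    have := neg_le_collisionInt hr (hsupp τ hτ0) hφL
      (hφ2.continuous.integrable_of_hasCompactSupport hφc) hφ
    rw [hmass] at this
    linarith

end WeakSolution

lemma measure_ball_eq_zero_iff {μ : Measure ℝ} {φ : ℝ → ℝ} {c r : ℝ} (hφ : ∀ ω, 0 ≤ φ ω)
    (hφi : Integrable φ μ) (hball : ∀ ω, φ ω ≠ 0 ↔ ω ∈ Metric.ball c r) :
    μ (Metric.ball c r) = 0 ↔ ∫ ω, φ ω ∂μ = 0 := by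
  have : Metric.ball c r = {ω | ¬ φ ω = 0} := by
    ext ω
    exact (hball ω).symm
  rw [integral_eq_zero_iff_of_nonneg hφ hφi, this]
  rfl

section WeakSolution

variable {ρ m r : ℝ} {gin : Measure ℝ} {g : ℝ → Measure ℝ}

lemma IsWeakSolution.msupport_init_subset (hg : IsWeakSolution ρ 0 gin g) (hm : HasMass m g)
    (hr : 0 < r) (hsupp : ∀ t, 0 ≤ t → g t (Iio r) = 0) {t : ℝ} (ht : 0 ≤ t) :
    msupport gin ⊆ msupport (g t) := by
  intro x hx b hb
  by_contra h0
  obtain ⟨φ, hφ2, ⟨L, hφL⟩, hφc, hφ, hball⟩ := exists_bump x hb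
  have hfin := (hm t ht).1
  have hfin0 := (hm 0 le_rfl).1
  have hi : ∀ (μ : Measure ℝ) [IsFiniteMeasure μ], Integrable φ μ := fun μ _ =>
    hφ2.continuous.integrable_of_hasCompactSupport hφc
  rw [pos_iff_ne_zero, not_not, measure_ball_eq_zero_iff hφ (hi _) hball] at h0
  have h1 := hg.integral_eq_zero_of_le hm hr hsupp hφ2 hφL hφc (R := x + b)
    (fun ω hω => by_contra fun hne => by
      have := (hball ω).mp hne
      rw [Metric.mem_ball, Real.dist_eq] at this
      linarith [(abs_lt.mp this).2]) hφ h0 0 ⟨le_rfl, ht⟩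
  rw [← measure_ball_eq_zero_iff hφ (hi _) hball, hg.2.2.1] at h1
  exact (hx b hb).ne' h1

/-- Collisions propagate the support instantaneously. -/
lemma IsWeakSolution.add_sub_mem_msupport (hg : IsWeakSolution ρ 0 gin g) (hm : HasMass m g)
    (hr : 0 < r) (hsupp : ∀ t, 0 ≤ t → g t (Iio r) = 0) {x y z : ℝ}
    (hx : ∀ t, 0 < t → x ∈ msupport (g t)) (hy : ∀ t, 0 < t → y ∈ msupport (g t))
    (hz : ∀ t, 0 < t → z ∈ msupport (g t)) (hw : 0 < x + y - z) {t : ℝ} (ht : 0 < t) :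
    x + y - z ∈ msupport (g t) := by
  intro b hb
  by_contra h0
  obtain ⟨φ, hφ2, ⟨L, hφL⟩, hφc, hφ, hball⟩ := exists_bump (x + y - z) hb
  have hfin := (hm t ht.le).1
  have hi : ∀ (μ : Measure ℝ) [IsFiniteMeasure μ], Integrable φ μ := fun μ _ =>
    hφ2.continuous.integrable_of_hasCompactSupport hφc
  have hR : ∀ ω, x + y - z + b ≤ ω → φ ω = 0 := fun ω hω => by_contra fun hne => by
    have := (hball ω).mp hne
    rw [Metric.mem_ball, Real.dist_eq] at this
    linarith [(abs_lt.mp this).2]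
  rw [pos_iff_ne_zero, not_not, measure_ball_eq_zero_iff hφ (hi _) hball] at h0
  have h1 := hg.integral_eq_zero_of_le hm hr hsupp hφ2 hφL hφc hR hφ h0
  have h2 := hg.integral_sub_integral hm hφ2 hφL hR le_rfl ht.le
  rw [h0, h1 0 ⟨le_rfl, ht.le⟩, sub_zero] at h2
  refine h2.not_lt (intervalIntegral.intervalIntegral_pos_of_pos_on
    ((intervalIntegrable_iff_integrableOn_Ioc_of_le ht.le).mpr
      (hg.integrableOn_collisionInt hm hφL t)) (fun s hs => ?_) ht)
  have hfins := (hm s hs.1.le).1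
  have h3 := neg_lt_collisionInt hr (hsupp s hs.1.le) hφL hφ2.continuous (hi _) hφ
    (hx s hs.1) (hy s hs.1) (hz s hs.1) hw ((hball _).mpr (Metric.mem_ball_self hb))
  rwa [h1 s ⟨hs.1.le, hs.2.le⟩, mul_zero, add_zero] at h3

lemma IsWeakSolution.le_sInf_extSet (hg : IsWeakSolution ρ 0 gin g) (hm : HasMass m g)
    (hm0 : 0 < m) (hr : 0 < r) (hsupp : ∀ t, 0 ≤ t → g t (Iio r) = 0) :
    r ≤ sInf (extSet (msupport gin)) := by
  have hpers : ∀ n, ∀ x ∈ iterSet (msupport gin) n, ∀ t, 0 < t → x ∈ msupport (g t) := by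
    intro n
    induction n with
    | zero => exact fun x hx t ht => hg.msupport_init_subset hm hr hsupp ht.le hx
    | succ n ih =>
      rintro _ ⟨⟨_, ⟨x, hx, y, hy, rfl⟩, z, hz, rfl⟩, hpos⟩ t ht
      exact hg.add_sub_mem_msupport hm hr hsupp (ih x hx) (ih y hy) (ih z hz) hpos ht
  have hne : gin univ ≠ 0 := by
    intro h0
    have h1 := (hm 0 le_rfl).2
    rw [hg.2.2.1, Measure.real, h0] at h1
    exact hm0.ne h1
  obtain ⟨x, hx⟩ := msupport_nonempty hne
  have hxr : r ≤ x := msupport_subset_Ici (hg.2.2.1 ▸ hsupp 0 le_rfl) hx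
  refine le_csInf ⟨x, mem_iUnion.mpr ⟨0, ⟨x + x, ⟨x, hx, x, hx, rfl⟩, x, hx, ?_⟩, ?_⟩⟩ ?_
  · exact add_sub_cancel_right x x
  · exact mem_Ioi.mpr (hr.trans_le hxr)
  · intro w hw
    obtain ⟨n, hn⟩ := mem_iUnion.mp hw
    exact msupport_subset_Ici (hsupp 1 zero_le_one) (hpers _ w hn 1 one_pos)

/-- If the extended support reaches `0`, some mass enters every neighbourhood of `0`. -/
lemma IsWeakSolution.exists_integral_trunc_pos (hg : IsWeakSolution ρ 0 gin g)
    (hm : HasMass m g) (hm0 : 0 < m) (hinf : sInf (extSet (msupport gin)) = 0) (hr : 0 < r) :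
    ∃ t, 0 ≤ t ∧ 0 < ∫ ω, trunc r ω ∂(g t) := by
  by_contra! hcon
  refine (hr.trans_le (hg.le_sInf_extSet hm hm0 hr fun t ht => ?_)).ne' hinf
  have hfin := (hm t ht).1
  have h0 : ∫ ω, trunc r ω ∂(g t) = 0 :=
    le_antisymm (hcon t ht) (integral_nonneg fun _ => trunc_nonneg _ _)
  rw [integral_eq_zero_iff_of_nonneg (fun _ => trunc_nonneg _ _)
    (integrable_trunc (hg.1 t ht).1 hr)] at h0
  rw [measure_eq_zero_iff_ae_notMem]
  filter_upwards [h0] with ω hω hωr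
  rw [trunc_of_le hr (le_of_lt hωr)] at hω
  have h1 : ω / r < 1 := (div_lt_one hr).mpr hωr
  have h2 : 0 < (1 - ω / r) ^ 3 := pow_pos (by linarith) 3
  exact h2.ne' hω

end WeakSolution

lemma mul_measureReal_Iic_le_integral_trunc {μ : Measure ℝ} [IsFiniteMeasure μ]
    (hμ : μ (Iio 0) = 0) {R : ℝ} (hR : 0 < R) (b : ℝ) :
    trunc R b * μ.real (Iic b) ≤ ∫ ω, trunc R ω ∂μ := by
  have e : trunc R b * μ.real (Iic b) = ∫ ω, (Iic b).indicator (fun _ => trunc R b) ω ∂μ := by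
    rw [integral_indicator_const _ measurableSet_Iic, smul_eq_mul, mul_comm]
  rw [e]
  refine integral_mono ((integrable_const _).indicator measurableSet_Iic)
    (integrable_trunc hμ hR) fun ω => ?_
  by_cases h : ω ∈ Iic b
  · rw [indicator_of_mem h]
    exact trunc_anti hR h
  · rw [indicator_of_notMem h]
    exact trunc_nonneg _ _

lemma integral_trunc_le_measureReal_Iic_add {μ : Measure ℝ} [IsFiniteMeasure μ]
    (hμ : μ (Iio 0) = 0) {R : ℝ} (hR : 0 < R) (a : ℝ) :
    ∫ ω, trunc R ω ∂μ ≤ μ.real (Iic a) + trunc R a * μ.real univ := by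
  have e : μ.real (Iic a) + trunc R a * μ.real univ
      = ∫ ω, ((Iic a).indicator (fun _ => (1 : ℝ)) ω + trunc R a) ∂μ := by
    rw [integral_add ((integrable_const _).indicator measurableSet_Iic) (integrable_const _),
      integral_indicator_const _ measurableSet_Iic, integral_const, smul_eq_mul, smul_eq_mul]
    ring
  rw [e]
  refine integral_mono_ae (integrable_trunc hμ hR)
    (((integrable_const _).indicator measurableSet_Iic).add (integrable_const _)) ?_
  filter_upwards [measure_eq_zero_iff_ae_notMem.mp hμ] with ω hω
  by_cases h : ω ∈ Iic a
  · rw [indicator_of_mem h]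
    linarith [trunc_le_one hR (not_lt.mp hω), trunc_nonneg R a]
  · rw [indicator_of_notMem h, zero_add]
    exact trunc_anti hR (le_of_lt (not_le.mp h))

lemma measureReal_Ioc_zero {μ : Measure ℝ} (hμ : μ (Iio 0) = 0) (h0 : μ {0} = 0) (b : ℝ) :
    μ.real (Ioc 0 b) = μ.real (Iic b) := by
  rw [← Ioi_inter_Iic]
  refine measureReal_congr (inter_eventuallyEq_right.mpr ?_)
  filter_upwards [measure_eq_zero_iff_ae_notMem.mp hμ, measure_eq_zero_iff_ae_notMem.mp h0]
    with ω h1 h2 _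
  exact (not_lt.mp h1).lt_of_ne' h2

section WeakSolution

variable {ρ m : ℝ} {gin : Measure ℝ} {g : ℝ → Measure ℝ}

lemma HasMass.measureReal_Iic (hm : HasMass m g) {t : ℝ} (ht : 0 ≤ t) (b : ℝ) :
    (g t).real (Iic b) = m - (g t).real (Ioi b) := by
  obtain ⟨hfin, hmass⟩ := hm t ht
  rw [← hmass, ← compl_Iic, measureReal_compl measurableSet_Iic]
  ring

lemma IsWeakSolution.exists_measureReal_Ioi_le (hg : IsWeakSolution ρ 0 gin g) (hρ : ρ < -1)
    (hm : HasMass m g) {δ : ℝ} (hδ : 0 < δ) :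
    ∃ L, 0 < L ∧ ∀ t, 0 ≤ t → (g t).real (Ioi L) ≤ δ := by
  have hfin := (hm 0 le_rfl).1
  have h0 := tendsto_integral_trunc_atTop (hg.1 0 le_rfl).1
  rw [(hm 0 le_rfl).2] at h0
  obtain ⟨L, hL1, hL0⟩ := ((h0.eventually (Ioi_mem_nhds (sub_lt_self m hδ))).and
    (eventually_gt_atTop 0)).exists
  refine ⟨L, hL0, fun t ht => ?_⟩
  have hfint := (hm t ht).1
  have h1 := hg.integral_trunc_mono hρ hL0 le_rfl ht
  have h2 := integral_trunc_le_measureReal_Iic_add (hg.1 t ht).1 hL0 L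
  rw [trunc_eq_zero hL0 le_rfl, zero_mul, add_zero, hm.measureReal_Iic ht] at h2
  have h3 : m - δ < ∫ ω, trunc L ω ∂(g 0) := hL1
  linarith

/-- All the mass eventually concentrates at the origin. -/
lemma IsWeakSolution.tendsto_measureReal_Ioi (hg : IsWeakSolution ρ 0 gin g) (hρ : ρ < -1)
    (hm : HasMass m g) (hm0 : 0 < m) (hinf : sInf (extSet (msupport gin)) = 0)
    (hc : ∀ t, 0 ≤ t → g t {0} = 0) {R : ℝ} (hR : 0 < R) :
    Tendsto (fun t => (g t).real (Ioi R)) atTop (nhds 0) := by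
  rw [Metric.tendsto_atTop]
  intro ε hε
  have hlim : Tendsto (fun δ : ℝ => (1 - δ) ^ 3 * (m - 2 * δ)) (nhdsWithin 0 (Ioi 0))
      (nhds ((1 - 0) ^ 3 * (m - 2 * 0))) :=
    (Continuous.tendsto (by fun_prop) 0).mono_left nhdsWithin_le_nhds
  obtain ⟨δ, hδm, hδ0, hδ1⟩ := ((hlim.eventually
    (Ioi_mem_nhds (show m - ε < (1 - 0) ^ 3 * (m - 2 * 0) by linarith))).and
    (Ioo_mem_nhdsGT (zero_lt_one' ℝ))).exists
  have hδm : m - ε < (1 - δ) ^ 3 * (m - 2 * δ) := hδm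
  set q := δ * R / 2 with hq
  have hq0 : 0 < q := by positivity
  obtain ⟨t0, ht0, hc0⟩ := hg.exists_integral_trunc_pos hm hm0 hinf hq0
  set c := ∫ ω, trunc q ω ∂(g t0)
  obtain ⟨L, hL0, hL⟩ := hg.exists_measureReal_Ioi_le hρ hm hδ0
  have hs : Tendsto (fun t : ℝ => 49152 * L * (√t)⁻¹) atTop (nhds (49152 * L * 0)) :=
    (tendsto_inv_atTop_zero.comp tendsto_sqrt_atTop).const_mul _
  rw [mul_zero] at hs
  obtain ⟨T, hT⟩ := eventually_atTop.mp (hs.eventually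
    (Iio_mem_nhds (show 0 < c * δ ^ 2 by positivity)))
  obtain ⟨t1, ht1, hTt⟩ := hg.exists_goodTimes_gt hρ hm hL0 (max t0 T)
  have ht01 : t0 ≤ t1 := (le_max_left _ _).trans hTt.le
  have ht1' : 0 ≤ t1 := ht0.trans ht01
  have hfin1 := (hm t1 ht1').1
  have hsmall : 49152 * L * (√t1)⁻¹ < c * δ ^ 2 := hT t1 ((le_max_right _ _).trans hTt.le)
  have hflux := ht1.2
  rw [max_eq_left ht1'] at hflux
  have hconc := concentration_of_fluxSum_le one_pos le_rfl hq0 hL0 (by positivity) hflux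
  have hcle : c ≤ (g t1).real (Ioc 0 q) := by
    rw [measureReal_Ioc_zero (hg.1 t1 ht1').1 (hc t1 ht1')]
    have h2 := integral_trunc_le_measureReal_Iic_add (hg.1 t1 ht1').1 hq0 q
    rw [trunc_eq_zero hq0 le_rfl, zero_mul, add_zero] at h2
    exact (hg.integral_trunc_mono hρ hq0 ht0 ht01).trans h2
  have hIoc : (g t1).real (Ioc (δ * R) L) ≤ δ := by
    rw [show (1 + 1) * q = δ * R by rw [hq]; ring, one_pow, one_mul] at hconc
    have h1 : c * (g t1).real (Ioc (δ * R) L) ^ 2 ≤ c * δ ^ 2 :=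
      (mul_le_mul_of_nonneg_right hcle (by positivity)).trans (hconc.trans hsmall.le)
    exact abs_le_of_sq_le_sq' (le_of_mul_le_mul_left h1 hc0) hδ0.le |>.2
  have hIoi : (g t1).real (Ioi (δ * R)) ≤ 2 * δ := by
    have : Ioi (δ * R) ⊆ Ioc (δ * R) L ∪ Ioi L := fun x hx => by
      rcases le_or_gt x L with h | h
      · exact Or.inl ⟨hx, h⟩
      · exact Or.inr h
    have := (measureReal_mono (μ := g t1) this).trans (measureReal_union_le _ _)
    linarith [hL t1 ht1']
  have hlow : m - ε < ∫ ω, trunc R ω ∂(g t1) := by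
    refine hδm.trans_le (le_trans ?_
      (mul_measureReal_Iic_le_integral_trunc (hg.1 t1 ht1').1 hR (δ * R)))
    rw [trunc_of_le hR (by nlinarith), mul_div_assoc, div_self hR.ne', mul_one,
      hm.measureReal_Iic ht1']
    have : 0 ≤ 1 - δ := by linarith
    gcongr
  refine ⟨t1, fun t ht => ?_⟩
  have ht' : 0 ≤ t := ht1'.trans ht
  have hfint := (hm t ht').1
  have h1 := hg.integral_trunc_mono hρ hR ht1' ht
  have h2 := integral_trunc_le_measureReal_Iic_add (hg.1 t ht').1 hR R
  rw [trunc_eq_zero hR le_rfl, zero_mul, add_zero, hm.measureReal_Iic ht'] at h2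
  rw [Real.dist_eq, sub_zero, abs_of_nonneg measureReal_nonneg]
  linarith

end WeakSolution

lemma exists_quantile {μ : Measure ℝ} [IsFiniteMeasure μ] (hμ : μ (Iio 0) = 0) (h0 : μ {0} = 0)
    {v κ : ℝ} (hv : 0 < v) (hv1 : v < μ.real univ) (hκ : 0 < κ) (hκ1 : κ < 1) :
    ∃ q, 0 < q ∧ v ≤ μ.real (Iic q) ∧ μ.real (Iic (κ * q)) < v := by
  set Q := {q | v ≤ μ.real (Iic q)}
  have hz := tendsto_integral_trunc_zero hμ
  rw [Measure.real, h0, ENNReal.toReal_zero] at hz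
  obtain ⟨R, hR1, hR0 : 0 < R⟩ := ((hz.eventually (Iio_mem_nhds (show 0 < v / 8 by positivity))).and
    self_mem_nhdsWithin).exists
  have hR1 : ∫ ω, trunc R ω ∂μ < v / 8 := hR1
  have hb : μ.real (Iic (R / 2)) < v := by
    have h1 := mul_measureReal_Iic_le_integral_trunc hμ hR0 (R / 2)
    rw [trunc_of_le hR0 (by linarith), show R / 2 / R = 1 / 2 by field_simp] at h1
    norm_num at h1
    linarith
  have hlb : ∀ q ∈ Q, R / 2 ≤ q := fun q hq => by
    by_contra hlt
    have : μ.real (Iic q) ≤ μ.real (Iic (R / 2)) :=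
      measureReal_mono (Iic_subset_Iic.mpr (not_le.mp hlt).le)
    have hq : v ≤ μ.real (Iic q) := hq
    linarith
  have hne : Q.Nonempty := by
    obtain ⟨b, hb1, hb0⟩ := (((tendsto_integral_trunc_atTop hμ).eventually
      (Ioi_mem_nhds hv1)).and (eventually_gt_atTop 0)).exists
    have h1 := integral_trunc_le_measureReal_Iic_add hμ hb0 b
    rw [trunc_eq_zero hb0 le_rfl, zero_mul, add_zero] at h1
    exact ⟨b, (le_of_lt hb1).trans h1⟩
  have hs : R / 2 ≤ sInf Q := le_csInf hne hlb
  have hs0 : 0 < sInf Q := by linarith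
  obtain ⟨q, hq, hlt⟩ := exists_lt_of_csInf_lt hne
    (show sInf Q < sInf Q / κ from (lt_div_iff₀ hκ).mpr (by nlinarith))
  rw [lt_div_iff₀ hκ] at hlt
  refine ⟨q, by linarith [hlb q hq], hq, ?_⟩
  by_contra hge
  have := csInf_le ⟨R / 2, hlb⟩ (show κ * q ∈ Q from not_lt.mp hge)
  linarith

/-- The relative width of the window which contains most of the mass at a good time. -/
def spread (m : ℝ) (g : ℝ → Measure ℝ) (t : ℝ) : ℝ :=
  (2 + √(49152 / m) / m) * (√t)⁻¹ ^ (1 / 5 : ℝ) + (g t).real (Ioi 1) / m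

/-- Most of the mass of `g t` lies in the window of centre `q` and relative width `η`. -/
def IsWindow (m : ℝ) (g : ℝ → Measure ℝ) (t q η : ℝ) : Prop :=
  0 < q ∧ m * (1 - η) ≤ (g t).real (Ioo (q * (1 - η)) (q * (1 + η)))

section WeakSolution

variable {ρ m : ℝ} {gin : Measure ℝ} {g : ℝ → Measure ℝ}

lemma spread_pos (hm0 : 0 < m) {t : ℝ} (ht : 0 < t) : 0 < spread m g t := by
  have : 0 < √t := by positivity
  unfold spread
  positivity

lemma IsWeakSolution.tendsto_spread (hg : IsWeakSolution ρ 0 gin g) (hρ : ρ < -1)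
    (hm : HasMass m g) (hm0 : 0 < m) (hinf : sInf (extSet (msupport gin)) = 0)
    (hc : ∀ t, 0 ≤ t → g t {0} = 0) : Tendsto (spread m g) atTop (nhds 0) := by
  have h1 : Tendsto (fun t : ℝ => (√t)⁻¹ ^ (1 / 5 : ℝ)) atTop (nhds 0) := by
    have := (tendsto_inv_atTop_zero.comp tendsto_sqrt_atTop).rpow_const
      (p := (1 / 5 : ℝ)) (Or.inr (by norm_num))
    rwa [zero_rpow (by norm_num)] at this
  have h2 := (h1.const_mul (2 + √(49152 / m) / m)).add
    ((hg.tendsto_measureReal_Ioi hρ hm hm0 hinf hc one_pos).div_const m)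
  rwa [mul_zero, zero_div, add_zero] at h2

lemma IsWeakSolution.exists_window (hg : IsWeakSolution ρ 0 gin g)
    (hm : HasMass m g) (hm0 : 0 < m) (hc : ∀ t, 0 ≤ t → g t {0} = 0) {t : ℝ}
    (ht : t ∈ goodTimes g 1) :
    ∃ q, IsWindow m g t q (spread m g t) := by
  obtain ⟨ht1, hflux⟩ := ht
  have ht0 : 0 ≤ t := by linarith
  rw [max_eq_left ht0] at hflux
  obtain ⟨hfin, hmass⟩ := hm t ht0
  have hst : 1 < √t := by rwa [lt_sqrt zero_le_one, one_pow]
  set ε := (√t)⁻¹ ^ (1 / 5 : ℝ) with hε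
  have hε0 : 0 < ε := by positivity
  have hε1 : ε < 1 := rpow_lt_one (by positivity) (inv_lt_one_of_one_lt₀ hst) (by norm_num)
  have hε5 : ε ^ 5 = (√t)⁻¹ := by
    rw [hε, ← rpow_natCast, ← rpow_mul (by positivity)]
    norm_num
  obtain ⟨q, hq0, hq1, hq2⟩ := exists_quantile (hg.1 t ht0).1 (hc t ht0) (v := ε * m)
    (κ := 1 - ε) (by positivity) (by rw [hmass]; nlinarith) (by linarith) (by linarith)
  refine ⟨q, hq0, ?_⟩
  set X := (g t).real (Ioc ((1 + ε) * q) 1)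
  have hX : X ≤ √(49152 / m) * ε := by
    have h1 := concentration_of_fluxSum_le hε0 hε1.le hq0 one_pos (by positivity) hflux
    rw [measureReal_Ioc_zero (hg.1 t ht0).1 (hc t ht0), ← hε5] at h1
    have h2 : ε ^ 3 * (m * X ^ 2) ≤ ε ^ 3 * (49152 * ε ^ 2) := by
      calc ε ^ 3 * (m * X ^ 2) = ε ^ 2 * (ε * m) * X ^ 2 := by ring
        _ ≤ ε ^ 2 * (g t).real (Iic q) * X ^ 2 := by gcongr
        _ ≤ _ := h1.trans (le_of_eq (by ring))
    have h3 := le_of_mul_le_mul_left h2 (by positivity)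
    refine abs_le_of_sq_le_sq' ?_ (by positivity) |>.2
    rw [mul_pow, sq_sqrt (by positivity), div_mul_eq_mul_div, le_div_iff₀ hm0]
    linarith
  set η := spread m g t with hη
  have hηm : m * η = 2 * ε * m + √(49152 / m) * ε + (g t).real (Ioi 1) := by
    rw [hη, spread, ← hε]
    field_simp
  have hεη : ε < η := by
    have : 0 ≤ √(49152 / m) * ε := by positivity
    have : 0 ≤ (g t).real (Ioi 1) := measureReal_nonneg
    refine lt_of_mul_lt_mul_left (a := m) ?_ hm0.le
    nlinarith
  have hcov : (univ : Set ℝ) ⊆ Ioo (q * (1 - η)) (q * (1 + η)) ∪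
      (Iic ((1 - ε) * q) ∪ (Ioc ((1 + ε) * q) 1 ∪ Ioi 1)) := by
    intro x _
    rcases le_or_gt x ((1 - ε) * q) with h1 | h1
    · exact Or.inr (Or.inl h1)
    rcases lt_or_ge 1 x with h2 | h2
    · exact Or.inr (Or.inr (Or.inr h2))
    rcases lt_or_ge ((1 + ε) * q) x with h3 | h3
    · exact Or.inr (Or.inr (Or.inl ⟨h3, h2⟩))
    · exact Or.inl ⟨by nlinarith, by nlinarith⟩
  have h1 := (measureReal_mono (μ := g t) hcov).trans ((measureReal_union_le _ _).trans
    (add_le_add le_rfl ((measureReal_union_le _ _).trans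
      (add_le_add le_rfl (measureReal_union_le _ _)))))
  rw [hmass] at h1
  have h2 : 0 < ε * m := by positivity
  linarith

lemma IsWindow.mono (hm : HasMass m g) (hm0 : 0 < m) {t q η δ : ℝ} (ht : 0 ≤ t)
    (h : IsWindow m g t q η) (hδ : η ≤ δ) : IsWindow m g t q δ := by
  obtain ⟨hq, hle⟩ := h
  have := (hm t ht).1
  refine ⟨hq, le_trans (by gcongr) (hle.trans (measureReal_mono (Ioo_subset_Ioo ?_ ?_)))⟩
  · gcongr
  · gcongr

lemma IsWeakSolution.eventually_window_le (hg : IsWeakSolution ρ 0 gin g) (hρ : ρ < -1)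
    (hm : HasMass m g) (hm0 : 0 < m) (hinf : sInf (extSet (msupport gin)) = 0)
    (hc : ∀ t, 0 ≤ t → g t {0} = 0) {δ : ℝ} (hδ : 0 < δ) :
    ∀ᶠ t in atTop, ∀ q, IsWindow m g t q (1 / 2) → q ≤ δ := by
  have h1 := (hg.tendsto_measureReal_Ioi hρ hm hm0 hinf hc (half_pos hδ)).eventually
    (Iio_mem_nhds (half_pos hm0))
  filter_upwards [h1, eventually_ge_atTop 0] with t ht ht0 q hq
  by_contra! hlt
  have hfin := (hm t ht0).1
  have h2 : (g t).real (Ioo (q * (1 - 1 / 2)) (q * (1 + 1 / 2))) ≤ (g t).real (Ioi (δ / 2)) :=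
    measureReal_mono fun x hx => mem_Ioi.mpr (by linarith [hx.1])
  have h3 := hq.2
  have h4 : (g t).real (Ioi (δ / 2)) < m / 2 := ht
  linarith

/-- The centres of narrow windows are almost nonincreasing in time. -/
lemma IsWeakSolution.exists_window_almost_anti (hg : IsWeakSolution ρ 0 gin g) (hρ : ρ < -1)
    (hm : HasMass m g) (hm0 : 0 < m) {ε : ℝ} (hε : 0 < ε) :
    ∃ δ, 0 < δ ∧ ∀ t s p q, 0 ≤ t → t ≤ s → IsWindow m g t p δ → IsWindow m g s q δ →
      q ≤ (1 + ε) * p := by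
  have hlim : Tendsto (fun δ : ℝ => (1 - (1 + δ) / (1 + ε)) ^ 3 * (1 - δ) - (δ + δ ^ 3))
      (nhdsWithin 0 (Ioi 0))
      (nhds ((1 - (1 + 0) / (1 + ε)) ^ 3 * (1 - 0) - (0 + 0 ^ 3))) :=
    (Continuous.tendsto (by fun_prop) 0).mono_left nhdsWithin_le_nhds
  have hpos : 0 < (1 - (1 + 0) / (1 + ε)) ^ 3 * (1 - 0) - (0 + 0 ^ 3) := by
    have : (1 + 0) / (1 + ε) < 1 := by rw [div_lt_one (by linarith)]; linarith
    have h2 : 0 < 1 - (1 + 0) / (1 + ε) := by linarith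
    have := pow_pos h2 3
    linarith
  obtain ⟨δ, h1, hδ0, hδm⟩ := ((hlim.eventually (Ioi_mem_nhds hpos)).and
    (Ioo_mem_nhdsGT (lt_min hε one_pos))).exists
  obtain ⟨hδε, hδ1⟩ := lt_min_iff.mp hδm
  have h1 : 0 < (1 - (1 + δ) / (1 + ε)) ^ 3 * (1 - δ) - (δ + δ ^ 3) := h1
  refine ⟨δ, hδ0, fun t s p q ht hts hp hq => ?_⟩
  by_contra! hlt
  have hs := ht.trans hts
  obtain ⟨hfint, -⟩ := hm t ht
  obtain ⟨hfins, hmass⟩ := hm s hs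
  obtain ⟨hp0, hp1⟩ := hp
  obtain ⟨hq0, hq1⟩ := hq
  have hR : 0 < (1 + ε) * p := by positivity
  have hlow := mul_measureReal_Iic_le_integral_trunc (hg.1 t ht).1 hR (p * (1 + δ))
  rw [trunc_of_le hR (by nlinarith),
    show p * (1 + δ) / ((1 + ε) * p) = (1 + δ) / (1 + ε) by field_simp] at hlow
  have hlow2 : m * (1 - δ) ≤ (g t).real (Iic (p * (1 + δ))) :=
    hp1.trans (measureReal_mono fun x hx => hx.2.le)
  have hup := integral_trunc_le_measureReal_Iic_add (hg.1 s hs).1 hR ((1 + ε) * p * (1 - δ))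
  rw [trunc_of_le hR (by nlinarith), mul_div_cancel_left₀ _ hR.ne', sub_sub_cancel, hmass] at hup
  have hup2 : (g s).real (Iic ((1 + ε) * p * (1 - δ))) ≤ m * δ := by
    rw [hm.measureReal_Iic hs]
    have : (g s).real (Ioo (q * (1 - δ)) (q * (1 + δ))) ≤
        (g s).real (Ioi ((1 + ε) * p * (1 - δ))) :=
      measureReal_mono fun x hx => mem_Ioi.mpr
        (lt_of_le_of_lt (mul_le_mul_of_nonneg_right hlt.le (by linarith)) hx.1)
    linarith
  have hmono := hg.integral_trunc_mono hρ hR ht hts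
  have h2 : 0 ≤ (1 - (1 + δ) / (1 + ε)) ^ 3 := by
    have : (1 + δ) / (1 + ε) ≤ 1 := by rw [div_le_one (by linarith)]; linarith
    exact pow_nonneg (by linarith) 3
  have h3 := mul_le_mul_of_nonneg_left hlow2 h2
  have h4 := mul_pos hm0 h1
  linarith

end WeakSolution

/-- Dichotomy: finite-time condensation or pulsating concentration towards `ω = 0`. -/
theorem condensation_or_pulsating_dichotomy
    (ρ : ℝ) (hρ : ρ < -1)
    (gin : Measure ℝ) (hgin : MemMplus ρ gin)
    (g : ℝ → Measure ℝ) (hg : IsWeakSolution ρ 0 gin g)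
    (m : ℝ) (hm : m = (gin Set.univ).toReal) (hmpos : 0 < m)
    (hRstar : sInf (extSet (msupport gin)) = 0) :
    Xor'
      -- alternative (i): finite-time condensation, with monotone condensate mass
      (∃ tstar : ℝ, 0 ≤ tstar ∧
        (∀ᵐ t ∂(volume.restrict (Set.Ici tstar)), 0 < g t ({0} : Set ℝ)) ∧
        (∀ᵐ p ∂((volume : Measure ℝ).prod (volume : Measure ℝ)),
          0 ≤ p.1 → p.1 ≤ p.2 → g p.1 ({0} : Set ℝ) ≤ g p.2 ({0} : Set ℝ)))
      -- alternative (ii): no condensation, pulsating concentration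
      ((∀ t : ℝ, 0 ≤ t → g t ({0} : Set ℝ) = 0) ∧
        ∃ A : Set ℝ, (∀ M : ℝ, ∃ t ∈ A, M < t) ∧
          Tendsto (fun T : ℝ => (volume (A ∩ Set.Icc 0 T)).toReal / T) atTop (nhds 1) ∧
          ∃ Om eta : ℝ → ℝ,
            (∀ t ∈ A, 0 < Om t ∧ 0 < eta t) ∧
            Tendsto eta (atTop ⊓ Filter.principal A) (nhds 0) ∧
            Tendsto Om (atTop ⊓ Filter.principal A) (nhds 0) ∧
            (∀ t ∈ A, ENNReal.ofReal (m * (1 - eta t)) ≤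
              g t (Set.Ioo (Om t * (1 - eta t)) (Om t * (1 + eta t)))) ∧
            (∀ ε : ℝ, 0 < ε → ∃ T₀ : ℝ, ∀ s t : ℝ, s ∈ A → t ∈ A →
              T₀ ≤ t → t ≤ s → Om s ≤ (1 + ε) * Om t)) := by
  have hmass : HasMass m g := hm ▸ hg.hasMass hρ (hm ▸ hmpos)
  by_cases hcond : ∃ t, 0 ≤ t ∧ g t {0} ≠ 0
  · obtain ⟨t0, ht0, hpos⟩ := hcond
    refine Or.inl ⟨⟨t0, ht0, ?_, ?_⟩, fun h => hpos (h.1 t0 ht0)⟩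
    · refine (ae_restrict_iff' measurableSet_Ici).mpr (.of_forall fun t ht => ?_)
      exact (pos_iff_ne_zero.mpr hpos).trans_le (hg.condensate_mono hρ hmass ht0 ht)
    · exact .of_forall fun p h1 h2 => hg.condensate_mono hρ hmass h1 h2
  push Not at hcond
  refine Or.inr ⟨⟨hcond, goodTimes g 1, hg.exists_goodTimes_gt hρ hmass one_pos,
    hg.tendsto_density_goodTimes hρ hmass one_pos, ?_⟩, ?_⟩
  · choose! Om hOm using fun t => hg.exists_window hmass hmpos hcond (t := t)
    have hspread := hg.tendsto_spread hρ hmass hmpos hRstar hcond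
    have hnonneg : ∀ t ∈ goodTimes g 1, 0 ≤ t := fun t ht => zero_le_one.trans ht.1.le
    have hwin : ∀ δ, 0 < δ → ∀ᶠ t in atTop, t ∈ goodTimes g 1 → IsWindow m g t (Om t) δ := by
      intro δ hδ
      filter_upwards [hspread.eventually (Iio_mem_nhds hδ)] with t ht htA
      exact (hOm t htA).mono hmass hmpos (hnonneg t htA) (le_of_lt ht)
    refine ⟨Om, spread m g, fun t ht => ⟨(hOm t ht).1, spread_pos hmpos (one_pos.trans ht.1)⟩,
      hspread.mono_left inf_le_left, ?_, fun t ht => ?_, fun ε hε => ?_⟩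
    · rw [Metric.tendsto_nhds]
      intro δ hδ
      rw [eventually_inf_principal]
      filter_upwards [hwin (1 / 2) (by norm_num),
        hg.eventually_window_le hρ hmass hmpos hRstar hcond (half_pos hδ)] with t h1 h2 htA
      rw [Real.dist_eq, sub_zero, abs_of_pos (hOm t htA).1]
      linarith [h2 _ (h1 htA)]
    · have := (hmass t (hnonneg t ht)).1
      exact ENNReal.ofReal_le_of_le_toReal (hOm t ht).2
    · obtain ⟨δ, hδ, hanti⟩ := hg.exists_window_almost_anti hρ hmass hmpos hε
      obtain ⟨T, hT⟩ := eventually_atTop.mp (hwin δ hδ)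
      exact ⟨T, fun s t hs ht hTt hts => hanti t s _ _ (hnonneg t ht) hts (hT t hTt ht)
        (hT s (hTt.trans hts) hs)⟩
  · rintro ⟨t0, ht0, hae, -⟩
    rw [ae_restrict_iff' measurableSet_Ici] at hae
    have h0 : volume (Ici t0) = 0 := by
      refine measure_eq_zero_iff_ae_notMem.mpr ?_
      filter_upwards [hae] with t ht htI
      exact (ht htI).ne' (hcond t (ht0.trans htI))
    simp at h0
end
end

section
/- Let G₀(ω) := ω^{−2/3} on (0,∞), and let J_n[G₀](1) be the particle flux of G₀ at ω = 1. Then J_n[G₀](1) admits the representation J_n[G₀](1) = −(1/3) ∭_{(0,∞)³} (ω₁ω₂ω₃)^{−7/6} [ √ω₋ · H¹_φ(ω₁,ω₂,ω₃) + √((ω₀+ω₋−ω₊)₊) · H²_φ(ω₁,ω₂,ω₃) ] dω₁ dω₂ dω₃, where φ(ω) := (1−ω)₊, and moreover J_n[G₀](1) < 0. -/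
open MeasureTheory Real Set Filter Pointwise

noncomputable section

/-- The Kolmogorov–Zakharov profile `G₀(ω) = ω^{-2/3}`. -/
def G0 (ω : ℝ) : ℝ := ω ^ (-(2:ℝ)/3)

/-- The integrand `Q[g](ω₁,ω₂,ω₃) = Φ g₁ g₂ g₃ / √(ω₁ω₂ω₃)`. -/
def Qker (gfn : ℝ → ℝ) (a b c : ℝ) : ℝ :=
  PhiKer 0 a b c * gfn a * gfn b * gfn c / Real.sqrt (a * b * c)

/-- `J_{n,1}`. -/
def Jn1 (gfn : ℝ → ℝ) (ω : ℝ) : ℝ :=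
  ∫ a in Set.Ioi (0:ℝ), (∫ b in Set.Ioo (0:ℝ) ω, (∫ c in Set.Ioi ω, Qker gfn a b c))

/-- `J_{n,2}`. -/
def Jn2 (gfn : ℝ → ℝ) (ω : ℝ) : ℝ :=
  ∫ a in Set.Ioo (0:ℝ) ω, (∫ b in Set.Ioi (ω - a), (∫ c in Set.Ioo (0:ℝ) (a + b - ω),
    Qker gfn a b c))

/-- `J_{n,3}`. -/
def Jn3 (gfn : ℝ → ℝ) (ω : ℝ) : ℝ :=
  -(∫ a in Set.Ioi (0:ℝ), (∫ b in Set.Ioi ω, (∫ c in Set.Ioo (0:ℝ) ω, Qker gfn a b c)))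

/-- `J_{n,4}`. -/
def Jn4 (gfn : ℝ → ℝ) (ω : ℝ) : ℝ :=
  -(∫ a in Set.Ioi ω, (∫ b in Set.Ioi (0:ℝ), (∫ c in Set.Ioo (a + b - ω) (a + b),
    Qker gfn a b c)))

/-- The particle flux `J_n[g](ω)`. -/
def Jn (gfn : ℝ → ℝ) (ω : ℝ) : ℝ := Jn1 gfn ω + Jn2 gfn ω + Jn3 gfn ω + Jn4 gfn ω

/-- The largest of three reals. -/
def wmax (a b c : ℝ) : ℝ := max a (max b c)

/-- The smallest of three reals. -/
def wmin (a b c : ℝ) : ℝ := min a (min b c)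

/-- The middle one of three reals. -/
def wmid (a b c : ℝ) : ℝ := a + b + c - wmax a b c - wmin a b c

/-- `H¹_φ = φ(ω₊+ω₋-ω₀) + φ(ω₊+ω₀-ω₋) - 2φ(ω₊)`. -/
def H1 (φ : ℝ → ℝ) (a b c : ℝ) : ℝ :=
  φ (wmax a b c + wmin a b c - wmid a b c) + φ (wmax a b c + wmid a b c - wmin a b c)
    - 2 * φ (wmax a b c)

/-- `H²_φ = φ(ω₊) + φ(ω₀+ω₋-ω₊) - φ(ω₀) - φ(ω₋)`. -/
def H2 (φ : ℝ → ℝ) (a b c : ℝ) : ℝ :=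
  φ (wmax a b c) + φ (wmid a b c + wmin a b c - wmax a b c) - φ (wmid a b c) - φ (wmin a b c)

/-- The test function `φ(ω) = (1-ω)₊`. -/
def phiTest (ω : ℝ) : ℝ := max (1 - ω) 0

/-- The density `Φ · (ω₁ω₂ω₃)^{-7/6}` of `Qker G0`, extended by zero outside the positive octant. -/
def kzDensity (p : ℝ × ℝ × ℝ) : ℝ :=
  if 0 < p.1 ∧ 0 < p.2.1 ∧ 0 < p.2.2 then
    PhiKer 0 p.1 p.2.1 p.2.2 * (p.1 * p.2.1 * p.2.2) ^ (-(7:ℝ)/6) else 0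

theorem phiKer_nonneg (a b c : ℝ) : 0 ≤ PhiKer 0 a b c := by
  unfold PhiKer Phi4
  split_ifs
  · positivity
  · exact le_rfl

theorem phiKer_le_fst (a b c : ℝ) : PhiKer 0 a b c ≤ √a := by
  unfold PhiKer Phi4
  split_ifs
  · refine (min_le_left _ _).trans ((min_le_left _ _).trans ?_)
    rcases le_total 0 a with h | h <;> simp [h, Real.sqrt_eq_zero_of_nonpos]
  · positivity

theorem phiKer_swap (a b c : ℝ) : PhiKer 0 a b c = PhiKer 0 b a c := by
  unfold PhiKer Phi4
  rw [add_comm b a, min_comm (√(max (b - 0) 0))]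

theorem phiKer_le_snd (a b c : ℝ) : PhiKer 0 a b c ≤ √b := by
  rw [phiKer_swap]; exact phiKer_le_fst _ _ _

theorem phiKer_le_thd (a b c : ℝ) : PhiKer 0 a b c ≤ √c := by
  unfold PhiKer Phi4
  split_ifs
  · refine (min_le_right _ _).trans ((min_le_left _ _).trans ?_)
    rcases le_total 0 c with h | h <;> simp [h, Real.sqrt_eq_zero_of_nonpos]
  · positivity

theorem phiKer_le_fourth (a b c : ℝ) : PhiKer 0 a b c ≤ √(a + b - c) := by
  unfold PhiKer Phi4
  split_ifs with h
  · refine (min_le_right _ _).trans ((min_le_right _ _).trans ?_)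
    simp [h]
  · positivity

theorem phiKer_smul {t : ℝ} (ht : 0 < t) (a b c : ℝ) :
    PhiKer 0 (t * a) (t * b) (t * c) = √t * PhiKer 0 a b c := by
  have key : ∀ x : ℝ, √(max (t * x - 0) 0) = √t * √(max (x - 0) 0) := by
    intro x
    rw [← Real.sqrt_mul ht.le, mul_max_of_nonneg _ _ ht.le]
    simp
  have h4 : t * a + t * b - t * c = t * (a + b - c) := by ring
  unfold PhiKer Phi4
  rw [h4]
  simp only [key, mul_nonneg_iff_of_pos_left ht, mul_ite, mul_zero,
    mul_min_of_nonneg _ _ (Real.sqrt_nonneg t)]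

theorem phiKer_eq_sqrt_of_le {a b c : ℝ} (hac : a ≤ c) (hbc : b ≤ c) :
    PhiKer 0 a b c = √(max (a + b - c) 0) := by
  unfold PhiKer Phi4
  split_ifs with h
  · simp only [sub_zero]
    rw [min_eq_right (a := √(max c 0)), min_eq_right]
    · refine le_min ?_ ?_ <;>
      exact Real.sqrt_le_sqrt (max_le_max_right _ (by linarith))
    · exact Real.sqrt_le_sqrt (max_le_max_right _ (by linarith))
  · rw [max_eq_right (by linarith), Real.sqrt_zero]

theorem phiKer_eq_sqrt_snd {a b c : ℝ} (hb : 0 < b) (hba : b ≤ a) (hca : c ≤ a) (hbc : b ≤ c) :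
    PhiKer 0 a b c = √b := by
  unfold PhiKer Phi4
  rw [if_pos (by linarith)]
  simp only [sub_zero]
  rw [max_eq_left (by linarith : 0 ≤ a), max_eq_left hb.le, max_eq_left (by linarith : 0 ≤ c),
    max_eq_left (by linarith : 0 ≤ a + b - c), min_eq_right (Real.sqrt_le_sqrt hba), min_eq_left]
  exact le_min (Real.sqrt_le_sqrt hbc) (Real.sqrt_le_sqrt (by linarith))

theorem phiKer_eq_sqrt_thd {a b c : ℝ} (hc : 0 < c) (hca : c ≤ a) (hcb : c ≤ b) :
    PhiKer 0 a b c = √c := by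
  unfold PhiKer Phi4
  rw [if_pos (by linarith)]
  simp only [sub_zero]
  rw [max_eq_left (by linarith : 0 ≤ a), max_eq_left (by linarith : 0 ≤ b), max_eq_left hc.le,
    max_eq_left (by linarith : 0 ≤ a + b - c), min_eq_left (a := √c), min_eq_right]
  · exact le_min (Real.sqrt_le_sqrt hca) (Real.sqrt_le_sqrt hcb)
  · exact Real.sqrt_le_sqrt (by linarith)

theorem qker_G0_eq {a b c : ℝ} (ha : 0 < a) (hb : 0 < b) (hc : 0 < c) :
    Qker G0 a b c = kzDensity (a, b, c) := by
  have key : ∀ x : ℝ, 0 < x → x ^ (-(7:ℝ)/6) = x ^ (-(2:ℝ)/3) * (√x)⁻¹ := by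
    intro x hx
    rw [Real.sqrt_eq_rpow, ← Real.rpow_neg hx.le, ← Real.rpow_add hx]
    norm_num
  unfold kzDensity Qker G0
  rw [if_pos ⟨ha, hb, hc⟩, key _ (by positivity), Real.mul_rpow (by positivity) hc.le,
    Real.mul_rpow ha.le hb.le]
  ring

theorem kzDensity_nonneg (p : ℝ × ℝ × ℝ) : 0 ≤ kzDensity p := by
  unfold kzDensity
  split_ifs with h
  · obtain ⟨h1, h2, h3⟩ := h
    have := phiKer_nonneg p.1 p.2.1 p.2.2
    positivity
  · exact le_rfl

theorem kzDensity_pos_of_ne_zero {p : ℝ × ℝ × ℝ} (h : kzDensity p ≠ 0) :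
    0 < p.1 ∧ 0 < p.2.1 ∧ 0 < p.2.2 ∧ 0 < p.1 + p.2.1 - p.2.2 := by
  unfold kzDensity at h
  split_ifs at h with hp
  · refine ⟨hp.1, hp.2.1, hp.2.2, ?_⟩
    by_contra! hd
    have := phiKer_le_fourth p.1 p.2.1 p.2.2
    rw [Real.sqrt_eq_zero_of_nonpos hd] at this
    have h0 := le_antisymm this (phiKer_nonneg _ _ _)
    simp [h0] at h
  · simp at h

theorem measurable_kzDensity : Measurable kzDensity := by
  unfold kzDensity PhiKer Phi4
  refine Measurable.ite ?_ ?_ measurable_const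
  · exact (measurableSet_lt measurable_const measurable_fst).inter
      ((measurableSet_lt measurable_const (measurable_fst.comp measurable_snd)).inter
        (measurableSet_lt measurable_const (measurable_snd.comp measurable_snd)))
  · refine Measurable.mul (Measurable.ite (measurableSet_le ?_ ?_) ?_ measurable_const) ?_ <;>
      fun_prop

theorem kzDensity_smul {t : ℝ} (ht : 0 < t) (p : ℝ × ℝ × ℝ) :
    kzDensity (t • p) = (t ^ 3)⁻¹ * kzDensity p := by
  obtain ⟨a, b, c⟩ := p
  unfold kzDensity
  simp only [Prod.smul_mk, smul_eq_mul, mul_pos_iff_of_pos_left ht]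
  split_ifs with h
  · obtain ⟨ha, hb, hc⟩ := h
    have hpow : √t * (t ^ 3) ^ (-(7:ℝ)/6) = (t ^ 3)⁻¹ := by
      rw [Real.sqrt_eq_rpow, ← Real.rpow_natCast, ← Real.rpow_mul ht.le, ← Real.rpow_add ht,
        ← Real.rpow_neg ht.le]
      norm_num
    rw [phiKer_smul ht, show t * a * (t * b) * (t * c) = t ^ 3 * (a * b * c) by ring,
      Real.mul_rpow (by positivity) (by positivity), ← hpow]
    ring
  · simp

/-- One-dimensional integrable majorant used for the collision density. -/
def kzMajorant (x : ℝ) : ℝ := (Ioi (0:ℝ)).indicator (fun x => √(√(min 1 x)) * x ^ (-(7:ℝ)/6)) x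

theorem integrable_kzMajorant : Integrable kzMajorant := by
  unfold kzMajorant
  rw [integrable_indicator_iff measurableSet_Ioi, ← Ioc_union_Ioi_eq_Ioi (zero_le_one (α := ℝ))]
  refine IntegrableOn.union ?_ ?_
  · have h : IntegrableOn (fun x : ℝ => x ^ (-(11:ℝ)/12)) (Ioc 0 1) := by
      rw [← intervalIntegrable_iff_integrableOn_Ioc_of_le zero_le_one]
      exact intervalIntegral.intervalIntegrable_rpow' (by norm_num)
    refine h.congr_fun (fun x hx => ?_) measurableSet_Ioc
    simp only [min_eq_right hx.2]
    rw [Real.sqrt_eq_rpow, Real.sqrt_eq_rpow, ← Real.rpow_mul hx.1.le, ← Real.rpow_add hx.1]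
    norm_num
  · refine (integrableOn_Ioi_rpow_of_lt (by norm_num : -(7:ℝ)/6 < -1) zero_lt_one).congr_fun
      (fun x hx => ?_) measurableSet_Ioi
    simp [min_eq_left (le_of_lt (mem_Ioi.1 hx))]

theorem kzDensity_le_majorant {p : ℝ × ℝ × ℝ} (hp : kzDensity p ≠ 0)
    (hle : PhiKer 0 p.1 p.2.1 p.2.2 ≤ 1)
    (hlarge : 1 / 2 ≤ p.1 ∨ 1 / 2 ≤ p.2.1 ∨ 1 / 2 ≤ p.2.2) :
    kzDensity p ≤ 2 * (kzMajorant p.1 * (kzMajorant p.2.1 * kzMajorant p.2.2)) := by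
  obtain ⟨ha, hb, hc, -⟩ := kzDensity_pos_of_ne_zero hp
  obtain ⟨a, b, c⟩ := p
  simp only at ha hb hc hle hlarge ⊢
  have h0 := phiKer_nonneg a b c
  have hbd : ∀ x : ℝ, PhiKer 0 a b c ≤ √x → PhiKer 0 a b c ≤ √(min 1 x) := by
    intro x hx
    rcases le_total 1 x with h | h
    · rw [min_eq_left h, Real.sqrt_one]; exact hle
    · rw [min_eq_right h]; exact hx
  have h1 := hbd a (phiKer_le_fst a b c)
  have h2 := hbd b (phiKer_le_snd a b c)
  have h3 := hbd c (phiKer_le_thd a b c)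
  have hhalf : ∀ x : ℝ, 1 / 2 ≤ x → 1 / 2 ≤ √(min 1 x) := by
    intro x hx
    apply Real.le_sqrt_of_sq_le
    rw [le_min_iff]
    constructor <;> nlinarith
  replace hlarge : 1 / 2 ≤ √(min 1 a) ∨ 1 / 2 ≤ √(min 1 b) ∨ 1 / 2 ≤ √(min 1 c) :=
    hlarge.imp (hhalf a) (Or.imp (hhalf b) (hhalf c))
  have key : PhiKer 0 a b c ≤ 2 * √(√(min 1 a) * √(min 1 b) * √(min 1 c)) := by
    rw [show (2:ℝ) = √4 by
      rw [show (4:ℝ) = 2 ^ 2 by norm_num]; exact (Real.sqrt_sq (by norm_num)).symm,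
      ← Real.sqrt_mul (by norm_num)]
    apply Real.le_sqrt_of_sq_le
    generalize √(min 1 a) = A at *
    generalize √(min 1 b) = B at *
    generalize √(min 1 c) = C at *
    generalize PhiKer 0 a b c = F at *
    have hAB := mul_le_mul h1 h2 h0 (h0.trans h1)
    have hAC := mul_le_mul h1 h3 h0 (h0.trans h1)
    have hBC := mul_le_mul h2 h3 h0 (h0.trans h2)
    have pAB := mul_nonneg (h0.trans h1) (h0.trans h2)
    have pAC := mul_nonneg (h0.trans h1) (h0.trans h3)
    have pBC := mul_nonneg (h0.trans h2) (h0.trans h3)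
    rcases hlarge with h | h | h
    · nlinarith [mul_le_mul_of_nonneg_right h pBC]
    · nlinarith [mul_le_mul_of_nonneg_right h pAC]
    · nlinarith [mul_le_mul_of_nonneg_right h pAB]
  unfold kzDensity kzMajorant
  rw [if_pos ⟨ha, hb, hc⟩, indicator_of_mem (mem_Ioi.2 ha), indicator_of_mem (mem_Ioi.2 hb),
    indicator_of_mem (mem_Ioi.2 hc)]
  simp only
  rw [Real.sqrt_mul (by positivity), Real.sqrt_mul (by positivity)] at key
  rw [Real.mul_rpow (by positivity) hc.le, Real.mul_rpow ha.le hb.le]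
  calc _ ≤ 2 * (√√(min 1 a) * √√(min 1 b) * √√(min 1 c)) *
        (a ^ (-(7:ℝ)/6) * b ^ (-(7:ℝ)/6) * c ^ (-(7:ℝ)/6)) :=
        mul_le_mul_of_nonneg_right key (by positivity)
    _ = _ := by ring

theorem kzMajorant_nonneg (x : ℝ) : 0 ≤ kzMajorant x := by
  unfold kzMajorant
  refine indicator_nonneg (fun x hx => ?_) x
  have : 0 < x := hx
  positivity

theorem integrable_kzDensity_indicator {S : Set (ℝ × ℝ × ℝ)} (hS : MeasurableSet S)
    (h : ∀ p ∈ S, kzDensity p ≠ 0 → PhiKer 0 p.1 p.2.1 p.2.2 ≤ 1 ∧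
      (1 / 2 ≤ p.1 ∨ 1 / 2 ≤ p.2.1 ∨ 1 / 2 ≤ p.2.2)) :
    Integrable (S.indicator kzDensity) := by
  have hm : Integrable (fun p : ℝ × ℝ × ℝ =>
      2 * (kzMajorant p.1 * (kzMajorant p.2.1 * kzMajorant p.2.2))) :=
    (integrable_kzMajorant.mul_prod
      (integrable_kzMajorant.mul_prod integrable_kzMajorant)).const_mul 2
  refine hm.mono' (measurable_kzDensity.indicator hS).aestronglyMeasurable
    (Eventually.of_forall fun p => ?_)
  have hn : 0 ≤ 2 * (kzMajorant p.1 * (kzMajorant p.2.1 * kzMajorant p.2.2)) := by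
    have := kzMajorant_nonneg
    have h1 := this p.1
    have h2 := this p.2.1
    have h3 := this p.2.2
    positivity
  by_cases hp : p ∈ S
  · rw [indicator_of_mem hp, Real.norm_of_nonneg (kzDensity_nonneg p)]
    by_cases h0 : kzDensity p = 0
    · rw [h0]; exact hn
    · exact kzDensity_le_majorant h0 (h p hp h0).1 (h p hp h0).2
  · rw [indicator_of_notMem hp, norm_zero]; exact hn

theorem integral_iterated_of_integrable {F : ℝ × ℝ × ℝ → ℝ} (hF : Integrable F) :
    ∫ p, F p = ∫ a, ∫ b, ∫ c, F (a, b, c) := by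
  rw [Measure.volume_eq_prod] at hF ⊢
  rw [integral_prod _ hF]
  refine integral_congr_ae ?_
  filter_upwards [hF.prod_right_ae] with a ha
  rw [Measure.volume_eq_prod] at ha ⊢
  exact integral_prod _ ha

theorem setIntegral_iterated {F : ℝ × ℝ × ℝ → ℝ} (f : ℝ → ℝ → ℝ → ℝ)
    {A : Set ℝ} {B : ℝ → Set ℝ} {C : ℝ → ℝ → Set ℝ} (hA : MeasurableSet A)
    (hB : ∀ a, MeasurableSet (B a)) (hC : ∀ a b, MeasurableSet (C a b)) (hF : Integrable F)
    (hmem : ∀ a b c, a ∈ A → b ∈ B a → c ∈ C a b → F (a, b, c) = f a b c)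
    (hnot : ∀ a b c, ¬ (a ∈ A ∧ b ∈ B a ∧ c ∈ C a b) → F (a, b, c) = 0) :
    ∫ a in A, (∫ b in B a, (∫ c in C a b, f a b c)) = ∫ p, F p := by
  rw [integral_iterated_of_integrable hF, ← integral_indicator hA]
  congr 1
  funext a
  by_cases ha : a ∈ A
  · rw [indicator_of_mem ha, ← integral_indicator (hB a)]
    congr 1
    funext b
    by_cases hb : b ∈ B a
    · rw [indicator_of_mem hb, ← integral_indicator (hC a b)]
      congr 1
      funext c
      by_cases hc : c ∈ C a b
      · rw [indicator_of_mem hc, hmem a b c ha hb hc]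
      · rw [indicator_of_notMem hc, hnot a b c (by tauto)]
    · rw [indicator_of_notMem hb]
      simp [fun c => hnot a b c (by tauto)]
  · rw [indicator_of_notMem ha]
    simp [fun b c => hnot a b c (by tauto)]

theorem integral_indicator_Ioo_eq {u v : ℝ} (hu : 0 ≤ u) (w : ℝ) :
    ∫ s in Ioo (0:ℝ) 1, (Ioo u v).indicator (fun _ => w) s =
      w * max (phiTest u - phiTest v) 0 := by
  rw [setIntegral_indicator measurableSet_Ioo, Ioo_inter_Ioo, setIntegral_const, smul_eq_mul,
    mul_comm, max_eq_right hu, Real.volume_real_Ioo, phiTest, phiTest]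
  congr 1
  simp only [max_def, min_def]
  split_ifs <;> linarith

/-- By scale invariance, the flux density through level `1` may be averaged over all levels
in `(0, 1)`. -/
theorem integral_level_average {u v : ℝ × ℝ × ℝ → ℝ} (hu : Measurable u) (hv : Measurable v)
    (hus : ∀ (t : ℝ) p, u (t • p) = t * u p) (hvs : ∀ (t : ℝ) p, v (t • p) = t * v p)
    (hpos : ∀ p, kzDensity p ≠ 0 → 0 ≤ u p)
    (hint : Integrable ({p | u p < 1 ∧ 1 < v p}.indicator kzDensity)) :
    Integrable (fun p => kzDensity p * max (phiTest (u p) - phiTest (v p)) 0) ∧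
      ∫ p, kzDensity p * max (phiTest (u p) - phiTest (v p)) 0 =
        ∫ p, {p | u p < 1 ∧ 1 < v p}.indicator kzDensity p := by
  have : (volume : Measure (ℝ × ℝ)).IsAddHaarMeasure := Measure.prod.instIsAddHaarMeasure _ _
  have : (volume : Measure (ℝ × ℝ × ℝ)).IsAddHaarMeasure := Measure.prod.instIsAddHaarMeasure _ _
  set K1 := {p | u p < 1 ∧ 1 < v p}.indicator kzDensity with hK1
  let K : ℝ × (ℝ × ℝ × ℝ) → ℝ := fun z =>
    {z : ℝ × (ℝ × ℝ × ℝ) | u z.2 < z.1 ∧ z.1 < v z.2}.indicator (fun z => kzDensity z.2) z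
  have hKm : Measurable K := by
    refine (measurable_kzDensity.comp measurable_snd).indicator ?_
    exact (measurableSet_lt (hu.comp measurable_snd) measurable_fst).inter
      (measurableSet_lt measurable_fst (hv.comp measurable_snd))
  have hK1n : ∀ p, 0 ≤ K1 p := fun p => indicator_nonneg (fun p _ => kzDensity_nonneg p) p
  have hKs : ∀ s : ℝ, 0 < s → ∀ p, K (s, p) = (s ^ 3)⁻¹ * K1 (s⁻¹ • p) := by
    intro s hs p
    have e1 : u (s⁻¹ • p) < 1 ↔ u p < s := by
      rw [hus, inv_mul_lt_iff₀ hs, mul_one]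
    have e2 : 1 < v (s⁻¹ • p) ↔ s < v p := by
      rw [hvs, lt_inv_mul_iff₀ hs, mul_one]
    simp only [K, hK1, indicator_apply, mem_ofPred_eq, e1, e2]
    split_ifs
    · rw [kzDensity_smul (inv_pos.2 hs)]
      field_simp
    · simp
  have hKn : ∀ s : ℝ, 0 < s → ∀ p, ‖K (s, p)‖ = K (s, p) := fun s hs p => by
    rw [Real.norm_of_nonneg]
    rw [hKs s hs]
    have := hK1n (s⁻¹ • p)
    positivity
  have hKint : ∀ s : ℝ, 0 < s → ∫ p, K (s, p) = ∫ p, K1 p := by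
    intro s hs
    simp only [hKs s hs]
    rw [integral_const_mul, Measure.integral_comp_smul]
    have : Module.finrank ℝ (ℝ × ℝ × ℝ) = 3 := by simp
    rw [this, smul_eq_mul, abs_of_pos (by positivity), inv_pow, inv_inv, ← mul_assoc,
      inv_mul_cancel₀ (by positivity), one_mul]
  have hKI : Integrable K ((volume.restrict (Ioo (0:ℝ) 1)).prod volume) := by
    rw [integrable_prod_iff hKm.aestronglyMeasurable]
    constructor
    · filter_upwards [ae_restrict_mem measurableSet_Ioo] with s hs
      simp only [hKs s hs.1]
      exact (hint.comp_smul (inv_ne_zero hs.1.ne')).const_mul _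
    · refine (integrable_const (∫ p, K1 p)).congr ?_
      filter_upwards [ae_restrict_mem measurableSet_Ioo] with s hs
      simp only [hKn s hs.1]
      exact (hKint s hs.1).symm
  have hinner : ∀ p, ∫ s in Ioo (0:ℝ) 1, K (s, p) =
      kzDensity p * max (phiTest (u p) - phiTest (v p)) 0 := by
    intro p
    by_cases h0 : kzDensity p = 0
    · have : ∀ s, K (s, p) = 0 := fun s => by simp [K, indicator_apply, h0]
      simp [this, h0]
    · rw [← integral_indicator_Ioo_eq (hpos p h0)]
      simp [K, indicator_apply]
  have hr := hKI.integral_prod_right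
  have hswap := integral_prod_symm K hKI
  rw [integral_prod K hKI] at hswap
  simp only [hinner] at hr hswap
  refine ⟨hr, ?_⟩
  rw [← hswap, setIntegral_congr_fun measurableSet_Ioo (fun s hs => hKint s hs.1)]
  simp

theorem Jn_G0_level_average :
    Integrable (fun p : ℝ × ℝ × ℝ => kzDensity p *
      (phiTest p.1 + phiTest p.2.1 - phiTest p.2.2 - phiTest (p.1 + p.2.1 - p.2.2))) ∧
    Jn G0 1 = ∫ p : ℝ × ℝ × ℝ, kzDensity p *
      (phiTest p.1 + phiTest p.2.1 - phiTest p.2.2 - phiTest (p.1 + p.2.1 - p.2.2)) := by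
  have m1 : Measurable fun p : ℝ × ℝ × ℝ => p.1 := by fun_prop
  have m2 : Measurable fun p : ℝ × ℝ × ℝ => p.2.1 := by fun_prop
  have m3 : Measurable fun p : ℝ × ℝ × ℝ => p.2.2 := by fun_prop
  have m4 : Measurable fun p : ℝ × ℝ × ℝ => p.1 + p.2.1 - p.2.2 := by fun_prop
  have s4 : ∀ (t : ℝ) (p : ℝ × ℝ × ℝ), (t • p).1 + (t • p).2.1 - (t • p).2.2 =
      t * (p.1 + p.2.1 - p.2.2) := by
    intro t p; simp only [Prod.smul_fst, Prod.smul_snd, smul_eq_mul]; ring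
  have le_one : ∀ {x y : ℝ}, y ≤ √x → x < 1 → y ≤ 1 := fun h1 h2 =>
    h1.trans (Real.sqrt_le_one.2 h2.le)
  have i1 : Integrable ({p : ℝ × ℝ × ℝ | p.2.1 < 1 ∧ 1 < p.2.2}.indicator kzDensity) := by
    refine integrable_kzDensity_indicator
      ((measurableSet_lt m2 measurable_const).inter (measurableSet_lt measurable_const m3))
      fun p hp _ => ⟨le_one (phiKer_le_snd _ _ _) hp.1, Or.inr (Or.inr (by linarith [hp.2]))⟩
  have i2 : Integrable ({p : ℝ × ℝ × ℝ | p.1 < 1 ∧ 1 < p.1 + p.2.1 - p.2.2}.indicator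
      kzDensity) := by
    refine integrable_kzDensity_indicator
      ((measurableSet_lt m1 measurable_const).inter (measurableSet_lt measurable_const m4))
      fun p hp h0 => ⟨le_one (phiKer_le_fst _ _ _) hp.1, ?_⟩
    by_contra! h
    linarith [hp.2, (kzDensity_pos_of_ne_zero h0).2.2.1, h.1, h.2.1]
  have i3 : Integrable ({p : ℝ × ℝ × ℝ | p.2.2 < 1 ∧ 1 < p.2.1}.indicator kzDensity) := by
    refine integrable_kzDensity_indicator
      ((measurableSet_lt m3 measurable_const).inter (measurableSet_lt measurable_const m2))
      fun p hp _ => ⟨le_one (phiKer_le_thd _ _ _) hp.1, Or.inr (Or.inl (by linarith [hp.2]))⟩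
  have i4 : Integrable ({p : ℝ × ℝ × ℝ | p.1 + p.2.1 - p.2.2 < 1 ∧ 1 < p.1}.indicator
      kzDensity) := by
    refine integrable_kzDensity_indicator
      ((measurableSet_lt m4 measurable_const).inter (measurableSet_lt measurable_const m1))
      fun p hp _ => ⟨le_one (phiKer_le_fourth _ _ _) hp.1, Or.inl (by linarith [hp.2])⟩
  obtain ⟨I1, E1⟩ := integral_level_average m2 m3 (fun _ _ => rfl) (fun _ _ => rfl)
    (fun p h => (kzDensity_pos_of_ne_zero h).2.1.le) i1
  obtain ⟨I2, E2⟩ := integral_level_average m1 m4 (fun _ _ => rfl) s4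
    (fun p h => (kzDensity_pos_of_ne_zero h).1.le) i2
  obtain ⟨I3, E3⟩ := integral_level_average m3 m2 (fun _ _ => rfl) (fun _ _ => rfl)
    (fun p h => (kzDensity_pos_of_ne_zero h).2.2.1.le) i3
  obtain ⟨I4, E4⟩ := integral_level_average m4 m1 s4 (fun _ _ => rfl)
    (fun p h => (kzDensity_pos_of_ne_zero h).2.2.2.le) i4
  have split : ∀ x y : ℝ, max (x - y) 0 - max (y - x) 0 = x - y := by
    intro x y
    rcases le_total x y with h | h
    · rw [max_eq_right (by linarith), max_eq_left (by linarith)]; ring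
    · rw [max_eq_left (by linarith), max_eq_right (by linarith)]; ring
  have hsum : (fun p : ℝ × ℝ × ℝ => kzDensity p *
      (phiTest p.1 + phiTest p.2.1 - phiTest p.2.2 - phiTest (p.1 + p.2.1 - p.2.2))) =
      fun p => kzDensity p * max (phiTest p.2.1 - phiTest p.2.2) 0 +
        kzDensity p * max (phiTest p.1 - phiTest (p.1 + p.2.1 - p.2.2)) 0 -
        kzDensity p * max (phiTest p.2.2 - phiTest p.2.1) 0 -
        kzDensity p * max (phiTest (p.1 + p.2.1 - p.2.2) - phiTest p.1) 0 := by
    funext p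
    have h1 := split (phiTest p.2.1) (phiTest p.2.2)
    have h2 := split (phiTest p.1) (phiTest (p.1 + p.2.1 - p.2.2))
    linear_combination -(kzDensity p) * h1 - kzDensity p * h2
  have J1 : Jn1 G0 1 = ∫ p, {p : ℝ × ℝ × ℝ | p.2.1 < 1 ∧ 1 < p.2.2}.indicator kzDensity p := by
    refine setIntegral_iterated _ measurableSet_Ioi (fun _ => measurableSet_Ioo)
      (fun _ _ => measurableSet_Ioi) i1 ?_ ?_
    · intro a b c ha hb hc
      simp only [mem_Ioi, mem_Ioo] at ha hb hc
      rw [qker_G0_eq ha hb.1 (by linarith), indicator_of_mem (by exact ⟨hb.2, hc⟩)]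
    · intro a b c h
      rw [indicator_apply_eq_zero]
      intro hp
      by_contra h0
      have := kzDensity_pos_of_ne_zero h0
      exact h ⟨this.1, ⟨this.2.1, hp.1⟩, hp.2⟩
  have J2 : Jn2 G0 1 = ∫ p,
      {p : ℝ × ℝ × ℝ | p.1 < 1 ∧ 1 < p.1 + p.2.1 - p.2.2}.indicator kzDensity p := by
    refine setIntegral_iterated _ measurableSet_Ioo (fun _ => measurableSet_Ioi)
      (fun _ _ => measurableSet_Ioo) i2 ?_ ?_
    · intro a b c ha hb hc
      simp only [mem_Ioi, mem_Ioo] at ha hb hc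
      rw [qker_G0_eq ha.1 (by linarith) hc.1,
        indicator_of_mem (by exact ⟨ha.2, by simp only; linarith⟩)]
    · intro a b c h
      rw [indicator_apply_eq_zero]
      intro hp
      by_contra h0
      obtain ⟨ha, hb, hc, -⟩ := kzDensity_pos_of_ne_zero h0
      simp only [mem_ofPred_eq, mem_Ioi, mem_Ioo] at *
      exact h ⟨⟨ha, hp.1⟩, by linarith, hc, by linarith⟩
  have J3 : Jn3 G0 1 = -∫ p,
      {p : ℝ × ℝ × ℝ | p.2.2 < 1 ∧ 1 < p.2.1}.indicator kzDensity p := by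
    refine congrArg Neg.neg (setIntegral_iterated _ measurableSet_Ioi (fun _ => measurableSet_Ioi)
      (fun _ _ => measurableSet_Ioo) i3 ?_ ?_)
    · intro a b c ha hb hc
      simp only [mem_Ioi, mem_Ioo] at ha hb hc
      rw [qker_G0_eq ha (by linarith) hc.1, indicator_of_mem (by exact ⟨hc.2, hb⟩)]
    · intro a b c h
      rw [indicator_apply_eq_zero]
      intro hp
      by_contra h0
      obtain ⟨ha, hb, hc, -⟩ := kzDensity_pos_of_ne_zero h0
      exact h ⟨ha, hp.2, hc, hp.1⟩
  have J4 : Jn4 G0 1 = -∫ p,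
      {p : ℝ × ℝ × ℝ | p.1 + p.2.1 - p.2.2 < 1 ∧ 1 < p.1}.indicator kzDensity p := by
    refine congrArg Neg.neg (setIntegral_iterated _ measurableSet_Ioi (fun _ => measurableSet_Ioi)
      (fun _ _ => measurableSet_Ioo) i4 ?_ ?_)
    · intro a b c ha hb hc
      simp only [mem_Ioi, mem_Ioo] at ha hb hc
      rw [qker_G0_eq (by linarith) hb (by linarith),
        indicator_of_mem (by exact ⟨by simp only; linarith, ha⟩)]
    · intro a b c h
      rw [indicator_apply_eq_zero]
      intro hp
      by_contra h0
      obtain ⟨ha, hb, hc, hd⟩ := kzDensity_pos_of_ne_zero h0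
      simp only [mem_ofPred_eq, mem_Ioi, mem_Ioo] at *
      exact h ⟨hp.2, hb, by linarith, by linarith⟩
  rw [hsum]
  refine ⟨((I1.add I2).sub I3).sub I4, ?_⟩
  refine Eq.trans ?_ (integral_sub ((I1.add I2).sub I3) I4).symm
  rw [integral_sub' (I1.add I2) I3, integral_add' I1 I2, E1, E2, E3, E4, Jn, J1, J2, J3, J4]
  ring

/-- The integrand of the symmetrized representation of the flux. -/
def kzSymm (a b c : ℝ) : ℝ :=
  (a * b * c) ^ (-(7:ℝ)/6) *
    (√(wmin a b c) * H1 phiTest a b c +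
      √(max (wmid a b c + wmin a b c - wmax a b c) 0) * H2 phiTest a b c)

theorem kzSymm_swap (a b c : ℝ) : kzSymm a b c = kzSymm b a c := by
  have h1 : wmax a b c = wmax b a c := max_left_comm _ _ _
  have h2 : wmin a b c = wmin b a c := min_left_comm _ _ _
  have h3 : wmid a b c = wmid b a c := by unfold wmid; rw [h1, h2]; ring
  unfold kzSymm H1 H2
  rw [h1, h2, h3, mul_comm a b]

theorem kzSymm_rotate (a b c : ℝ) : kzSymm a b c = kzSymm b c a := by
  have h1 : wmax a b c = wmax b c a := by unfold wmax; rw [max_comm, max_assoc]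
  have h2 : wmin a b c = wmin b c a := by unfold wmin; rw [min_comm, min_assoc]
  have h3 : wmid a b c = wmid b c a := by unfold wmid; rw [h1, h2]; ring
  unfold kzSymm H1 H2
  rw [h1, h2, h3, show a * b * c = b * c * a by ring]

theorem kzSymm_of_le {a b c : ℝ} (hab : a ≤ b) (hbc : b ≤ c) :
    kzSymm a b c = (a * b * c) ^ (-(7:ℝ)/6) *
      (√a * (phiTest (c + a - b) + phiTest (c + b - a) - 2 * phiTest c) +
        √(max (b + a - c) 0) * (phiTest c + phiTest (b + a - c) - phiTest b - phiTest a)) := by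
  have h1 : wmax a b c = c := by
    unfold wmax; rw [max_eq_right hbc, max_eq_right (hab.trans hbc)]
  have h2 : wmin a b c = a := by unfold wmin; rw [min_eq_left hbc, min_eq_left hab]
  have h3 : wmid a b c = b := by unfold wmid; rw [h1, h2]; ring
  unfold kzSymm H1 H2
  rw [h1, h2, h3]

/-- The weak-form integrand with test function `phiTest`. -/
def kzWeak (p : ℝ × ℝ × ℝ) : ℝ :=
  kzDensity p * (phiTest p.1 + phiTest p.2.1 - phiTest p.2.2 - phiTest (p.1 + p.2.1 - p.2.2))

theorem kzWeak_swap (a b c : ℝ) : kzWeak (a, b, c) = kzWeak (b, a, c) := by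
  unfold kzWeak kzDensity
  simp only
  rw [phiKer_swap, mul_comm a b, add_comm a b, add_comm (phiTest a)]
  congr 2
  simp only [eq_iff_iff]
  tauto

theorem sorted_induction {P : ℝ → ℝ → ℝ → Prop} (hs : ∀ a b c, P a b c → P b a c)
    (hr : ∀ a b c, P a b c → P b c a) (h : ∀ a b c, a ≤ b → b ≤ c → P a b c) (a b c : ℝ) :
    P a b c := by
  rcases le_total a b with h1 | h1 <;> rcases le_total b c with h2 | h2 <;>
    rcases le_total a c with h3 | h3
  · exact h _ _ _ h1 h2
  · exact h _ _ _ h1 h2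
  · exact hr _ _ _ (hs _ _ _ (h a c b h3 h2))
  · exact hr _ _ _ (h c a b h3 h1)
  · exact hs _ _ _ (h b a c h1 h3)
  · exact hr _ _ _ (hr _ _ _ (h b c a h2 h3))
  · exact hs _ _ _ (h b a c h1 h3)
  · exact hr _ _ _ (hr _ _ _ (hs _ _ _ (h c b a h2 h1)))

theorem kzWeak_cyclic_sum (a b c : ℝ) : 0 < a → 0 < b → 0 < c →
    kzWeak (a, b, c) + kzWeak (b, c, a) + kzWeak (c, a, b) = -kzSymm a b c := by
  refine sorted_induction (P := fun a b c => 0 < a → 0 < b → 0 < c →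
    kzWeak (a, b, c) + kzWeak (b, c, a) + kzWeak (c, a, b) = -kzSymm a b c) ?_ ?_ ?_ a b c
  · intro a b c h hb ha hc
    rw [kzSymm_swap, ← h ha hb hc, kzWeak_swap b a c, kzWeak_swap a c b, kzWeak_swap c b a]
    ring
  · intro a b c h hb hc ha
    rw [← kzSymm_rotate, ← h ha hb hc]
    ring
  · intro a b c hab hbc ha hb hc
    rw [kzSymm_of_le hab hbc]
    unfold kzWeak kzDensity
    simp only [ha, hb, hc, and_self, if_true]
    rw [phiKer_eq_sqrt_of_le (hab.trans hbc) hbc,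
      phiKer_eq_sqrt_thd ha hab (hab.trans hbc),
      phiKer_eq_sqrt_snd ha (hab.trans hbc) hbc hab,
      show b * c * a = a * b * c by ring, show c * a * b = a * b * c by ring,
      add_comm b c, add_comm b a]
    ring

theorem kzSymm_nonneg (a b c : ℝ) : 0 < a → 0 < b → 0 < c → 0 ≤ kzSymm a b c := by
  refine sorted_induction (P := fun a b c => 0 < a → 0 < b → 0 < c → 0 ≤ kzSymm a b c)
    ?_ ?_ ?_ a b c
  · intro a b c h hb ha hc
    rw [kzSymm_swap]; exact h ha hb hc
  · intro a b c h hb hc ha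
    rw [← kzSymm_rotate]; exact h ha hb hc
  · intro a b c hab hbc ha hb hc
    rw [kzSymm_of_le hab hbc]
    have e1 : 0 ≤ phiTest (c + a - b) + phiTest (c + b - a) - 2 * phiTest c := by
      simp only [phiTest, max_def]
      split_ifs <;> linarith
    have e2 : 0 ≤ phiTest c + phiTest (b + a - c) - phiTest b - phiTest a := by
      simp only [phiTest, max_def]
      split_ifs <;> linarith
    positivity

theorem kzSymm_pos_of_mem_box {a b c : ℝ} (ha : a ∈ Ioo (0.1:ℝ) 0.2) (hb : b ∈ Ioo (0.5:ℝ) 0.6)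
    (hc : c ∈ Ioo (1.1:ℝ) 1.2) : 0 < kzSymm a b c := by
  obtain ⟨ha1, ha2⟩ := ha
  obtain ⟨hb1, hb2⟩ := hb
  obtain ⟨hc1, hc2⟩ := hc
  norm_num at *
  rw [kzSymm_of_le (by linarith) (by linarith), max_eq_right (by linarith), Real.sqrt_zero,
    zero_mul, add_zero]
  have ha0 : 0 < a := by linarith
  have hb0 : 0 < b := by linarith
  have hc0 : 0 < c := by linarith
  have e1 : 0 < phiTest (c + a - b) + phiTest (c + b - a) - 2 * phiTest c := by
    simp only [phiTest]
    rw [max_eq_left (by linarith), max_eq_right (by linarith), max_eq_right (by linarith)]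
    linarith
  positivity

/-- The cyclic permutation of the coordinates of `ℝ × ℝ × ℝ`. -/
def rotateEquiv : (ℝ × ℝ × ℝ) ≃ᵐ (ℝ × ℝ × ℝ) :=
  MeasurableEquiv.prodComm.trans MeasurableEquiv.prodAssoc

theorem measurePreserving_rotateEquiv : MeasurePreserving rotateEquiv :=
  (measurePreserving_prodAssoc volume volume volume).comp Measure.measurePreserving_swap

theorem integral_kzSymm :
    Integrable (fun p : ℝ × ℝ × ℝ =>
      (Ioi (0:ℝ) ×ˢ Ioi (0:ℝ) ×ˢ Ioi (0:ℝ)).indicator (fun p => kzSymm p.1 p.2.1 p.2.2) p) ∧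
    Jn G0 1 = -(1/3) * ∫ p : ℝ × ℝ × ℝ,
      (Ioi (0:ℝ) ×ˢ Ioi (0:ℝ) ×ˢ Ioi (0:ℝ)).indicator (fun p => kzSymm p.1 p.2.1 p.2.2) p := by
  obtain ⟨hI, hJ⟩ := Jn_G0_level_average
  change Integrable kzWeak at hI
  change Jn G0 1 = ∫ p, kzWeak p at hJ
  have hr := measurePreserving_rotateEquiv
  have hI1 : Integrable (fun p => kzWeak (rotateEquiv p)) := hr.integrable_comp_of_integrable hI
  have hI2 : Integrable (fun p => kzWeak (rotateEquiv (rotateEquiv p))) :=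
    hr.integrable_comp_of_integrable hI1
  have e1 : ∫ p, kzWeak (rotateEquiv p) = ∫ p, kzWeak p := hr.integral_comp' _
  have e2 : ∫ p, kzWeak (rotateEquiv (rotateEquiv p)) = ∫ p, kzWeak (rotateEquiv p) :=
    hr.integral_comp' (fun p => kzWeak (rotateEquiv p))
  have heq : (fun p : ℝ × ℝ × ℝ =>
      (Ioi (0:ℝ) ×ˢ Ioi (0:ℝ) ×ˢ Ioi (0:ℝ)).indicator (fun p => kzSymm p.1 p.2.1 p.2.2) p) =
      fun p => -(kzWeak p + kzWeak (rotateEquiv p) + kzWeak (rotateEquiv (rotateEquiv p))) := by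
    funext p
    obtain ⟨a, b, c⟩ := p
    change _ = -(kzWeak (a, b, c) + kzWeak (b, c, a) + kzWeak (c, a, b))
    by_cases h : 0 < a ∧ 0 < b ∧ 0 < c
    · rw [kzWeak_cyclic_sum a b c h.1 h.2.1 h.2.2, neg_neg]
      exact indicator_of_mem (by exact ⟨h.1, h.2.1, h.2.2⟩) _
    · rw [indicator_of_notMem (by exact h)]
      have hbca : ¬ (0 < b ∧ 0 < c ∧ 0 < a) := by tauto
      have hcab : ¬ (0 < c ∧ 0 < a ∧ 0 < b) := by tauto
      simp [kzWeak, kzDensity, h, hbca, hcab]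
  rw [heq]
  refine ⟨((hI.add hI1).add hI2).neg, ?_⟩
  have e3 := integral_add (hI.add hI1) hI2
  rw [integral_add' hI hI1, e2, e1] at e3
  rw [integral_neg, hJ]
  refine Eq.trans ?_ (congrArg (fun x => -(1/3) * -x) e3.symm)
  ring

/-- Representation formula and strict negativity of the particle flux of the
Kolmogorov–Zakharov solution (Theorem 2.29). -/
theorem KZ_particle_flux_negative :
    Jn G0 1 =
      -(1/3) * (∫ a in Set.Ioi (0:ℝ), (∫ b in Set.Ioi (0:ℝ), (∫ c in Set.Ioi (0:ℝ),
        (a * b * c) ^ (-(7:ℝ)/6) *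
          (Real.sqrt (wmin a b c) * H1 phiTest a b c +
            Real.sqrt (max (wmid a b c + wmin a b c - wmax a b c) 0) *
              H2 phiTest a b c)))) ∧
    Jn G0 1 < 0 := by
  obtain ⟨hI, hJ⟩ := integral_kzSymm
  constructor
  · rw [hJ]
    congr 1
    refine (setIntegral_iterated kzSymm measurableSet_Ioi (fun _ => measurableSet_Ioi)
      (fun _ _ => measurableSet_Ioi) hI ?_ ?_).symm
    · intro a b c ha hb hc
      exact indicator_of_mem (by exact ⟨ha, hb, hc⟩) _
    · intro a b c h
      exact indicator_of_notMem (by exact h) _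
  · rw [hJ]
    have hpos : 0 < ∫ p : ℝ × ℝ × ℝ, (Ioi (0:ℝ) ×ˢ Ioi (0:ℝ) ×ˢ Ioi (0:ℝ)).indicator
        (fun p => kzSymm p.1 p.2.1 p.2.2) p := by
      rw [integral_pos_iff_support_of_nonneg _ hI]
      · have hsub : Ioo (0.1:ℝ) 0.2 ×ˢ Ioo (0.5:ℝ) 0.6 ×ˢ Ioo (1.1:ℝ) 1.2 ⊆
            Function.support (fun p : ℝ × ℝ × ℝ => (Ioi (0:ℝ) ×ˢ Ioi (0:ℝ) ×ˢ Ioi (0:ℝ)).indicator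
              (fun p => kzSymm p.1 p.2.1 p.2.2) p) := by
          rintro ⟨a, b, c⟩ ⟨ha, hb, hc⟩
          have h := kzSymm_pos_of_mem_box ha hb hc
          rw [Function.mem_support, indicator_of_mem]
          · exact h.ne'
          · exact ⟨lt_trans (by norm_num) ha.1, lt_trans (by norm_num) hb.1,
              lt_trans (by norm_num) hc.1⟩
        refine lt_of_lt_of_le (IsOpen.measure_pos volume
          (isOpen_Ioo.prod (isOpen_Ioo.prod isOpen_Ioo)) ?_) (measure_mono hsub)
        exact ⟨(0.15, 0.55, 1.15), by norm_num, by norm_num, by norm_num⟩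
      · exact fun p => indicator_nonneg
          (fun p hp => kzSymm_nonneg _ _ _ hp.1 hp.2.1 hp.2.2) p
    linarith
end
end
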